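/- arXiv:1512.00321 — 3 statements merged into one kernel-verified Lean document; each statement's English description precedes it below -/
import Mathlib

section
/- Let n ≥ 2, let r ∈ ℕ ∪ {∞} with r ≥ 2, let U ⊆ ℝⁿ be open, p ∈ U, and let Γ^h_{ij} : U → ℝ be connection components of differentiability class Cʳ on U. Then there exist open sets U′ ⊆ U with p ∈ U′ and V ⊆ ℝⁿ, and a bijection f : U′ → V such that both f and its inverse g := f⁻¹ are of class Cʳ, and the transformed connection components Γ′^h_{ij}(x′) := Σ_γ [ Σ_{α,β} Γ^γ_{αβ}(g(x′)) ∂g^α/∂x′^i(x′) ∂g^β/∂x′^j(x′) + ∂²g^γ/∂x′^i∂x′^j(x′) ] ∂f^h/∂x^γ(g(x′)) satisfy Γ′^h_{11}(x′) = 0 for all x′ ∈ V and all h ∈ {1,…,n}, and Γ′^h_{ij} is of class C^{r−2} on V. -/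
open Set

/-- Partial derivative `∂φ/∂xⁱ` of a scalar function on `ℝⁿ`. -/
noncomputable def pd {n : ℕ} (i : Fin n) (φ : (Fin n → ℝ) → ℝ) (x : Fin n → ℝ) : ℝ :=
  fderiv ℝ φ x (Pi.single i 1)

/-- The transformation law for the components of an affine connection under the
coordinate change `x' = f(x)` with inverse `g`:
`Γ′^h_{ij}(x′) = Σ_γ [ Σ_{α,β} Γ^γ_{αβ}(g(x′)) ∂g^α/∂x′^i ∂g^β/∂x′^j + ∂²g^γ/∂x′^i∂x′^j ] ∂f^h/∂x^γ(g(x′))`. -/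
noncomputable def transConn {n : ℕ} (Γ : Fin n → Fin n → Fin n → (Fin n → ℝ) → ℝ)
    (f g : (Fin n → ℝ) → (Fin n → ℝ)) (h i j : Fin n) (x' : Fin n → ℝ) : ℝ :=
  ∑ γ, ((∑ α, ∑ β, Γ γ α β (g x') * pd i (fun y => g y α) x' * pd j (fun y => g y β) x')
      + pd i (fun y => pd j (fun z => g z γ) y) x') * pd γ (fun x => f x h) (g x')


open Topology in
theorem nemytskii_hasFDerivAt {I : Type} [TopologicalSpace I] [CompactSpace I]
    {E F : Type} [NormedAddCommGroup E] [NormedSpace ℝ E]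
    [NormedAddCommGroup F] [NormedSpace ℝ F] (f : E → F) (hf : ContDiff ℝ 1 f)
    (L : C(I, E) → C(I, E) →L[ℝ] C(I, F))
    (hL : ∀ u w t, L u w t = fderiv ℝ f (u t) (w t)) (u : C(I, E)) :
    HasFDerivAt (fun u : C(I, E) => (ContinuousMap.mk f hf.continuous).comp u) (L u) u := by
  rw [hasFDerivAt_iff_isLittleO_nhds_zero, Asymptotics.isLittleO_iff]
  intro c hc
  have hcont : Continuous (fderiv ℝ f) := hf.continuous_fderiv (by norm_num)
  have hcomp : IsCompact (range u) := isCompact_range u.continuous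
  have h1 := hcomp.uniformContinuousAt_of_continuousAt (f := fderiv ℝ f)
    (fun a _ => hcont.continuousAt) (Metric.dist_mem_uniformity hc)
  obtain ⟨δ, hδ, h2⟩ := Metric.mem_uniformity_dist.1 h1
  filter_upwards [Metric.ball_mem_nhds (0 : C(I, E)) hδ] with w hw
  rw [mem_ball_zero_iff] at hw
  rw [ContinuousMap.norm_le _ (by positivity)]
  intro t
  have hwt : ‖w t‖ ≤ ‖w‖ := w.norm_coe_le_norm t
  have h3 := (convex_ball (u t) δ).norm_image_sub_le_of_norm_fderiv_le' (𝕜 := ℝ) (f := f)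
    (φ := fderiv ℝ f (u t)) (C := c) (x := u t) (y := u t + w t)
    (fun x _ => (hf.differentiable (by norm_num)) x) (fun x hx => by
      have := @h2 (u t) x (by rw [dist_comm]; exact hx) (mem_range_self t)
      have h4 : dist (fderiv ℝ f (u t)) (fderiv ℝ f x) < c := this
      rw [dist_comm, dist_eq_norm] at h4
      exact h4.le) (Metric.mem_ball_self hδ) (by
      rw [mem_ball_iff_norm]; simpa using lt_of_le_of_lt hwt hw)
  simp only [ContinuousMap.sub_apply, ContinuousMap.comp_apply, ContinuousMap.coe_mk, hL,
    ContinuousMap.add_apply]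
  rw [add_sub_cancel_left] at h3
  refine h3.trans ?_
  gcongr

/-- pointwise application as a bounded operator -/
noncomputable def ptApply {I : Type} [TopologicalSpace I] [CompactSpace I]
    {E F : Type} [NormedAddCommGroup E] [NormedSpace ℝ E]
    [NormedAddCommGroup F] [NormedSpace ℝ F] :
    C(I, E →L[ℝ] F) →L[ℝ] C(I, E) →L[ℝ] C(I, F) :=
  LinearMap.mkContinuous₂
    (LinearMap.mk₂ ℝ (fun (A : C(I, E →L[ℝ] F)) (w : C(I, E)) =>
        (⟨fun t => A t (w t), by fun_prop⟩ : C(I, F)))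
      (fun _ _ _ => by ext; simp) (fun _ _ _ => by ext; simp)
      (fun _ _ _ => by ext; simp) (fun _ _ _ => by ext; simp)) 1 (fun A w => by
      rw [ContinuousMap.norm_le _ (by positivity)]
      intro t
      rw [one_mul]
      exact (ContinuousLinearMap.le_opNorm _ _).trans
        (mul_le_mul (A.norm_coe_le_norm t) (w.norm_coe_le_norm t) (norm_nonneg _) (by positivity)))

theorem nemytskii_contDiff_nat {I : Type} [TopologicalSpace I] [CompactSpace I]
    {E : Type} [NormedAddCommGroup E] [NormedSpace ℝ E] (n : ℕ) :
    ∀ {F : Type} [NormedAddCommGroup F] [NormedSpace ℝ F] (f : E → F) (hf : ContDiff ℝ n f),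
    ContDiff ℝ n (fun u : C(I, E) => (ContinuousMap.mk f hf.continuous).comp u) := by
  induction n with
  | zero =>
    intro F _ _ f hf
    simp only [Nat.cast_zero]
    rw [contDiff_zero]
    exact ContinuousMap.continuous_postcomp _
  | succ n ih =>
    intro F _ _ f hf
    have hd : ContDiff ℝ n (fderiv ℝ f) :=
      hf.fderiv_right (by push_cast; rfl)
    have hp : ContDiff ℝ n (fun A : C(I, E →L[ℝ] F) =>
        (ptApply A : C(I, E) →L[ℝ] C(I, F))) :=
      IsBoundedLinearMap.contDiff ⟨⟨map_add _, map_smul _⟩, 1, one_pos, fun A => by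
        refine ContinuousLinearMap.opNorm_le_bound _ (by positivity) fun w => ?_
        rw [ContinuousMap.norm_le _ (by positivity), one_mul]
        intro t
        exact (ContinuousLinearMap.le_opNorm _ _).trans
          (mul_le_mul (A.norm_coe_le_norm t) (w.norm_coe_le_norm t) (norm_nonneg _)
            (by positivity))⟩
    push_cast
    rw [contDiff_succ_iff_hasFDerivAt]
    refine ⟨fun u => ptApply ((ContinuousMap.mk (fderiv ℝ f) hd.continuous).comp u),
      hp.comp (ih _ hd), fun u => ?_⟩
    exact nemytskii_hasFDerivAt f (hf.of_le (by push_cast; simp)) 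
      (fun u => ptApply ((ContinuousMap.mk (fderiv ℝ f) hd.continuous).comp u))
      (fun u w t => rfl) u

theorem nemytskii_contDiff {I : Type} [TopologicalSpace I] [CompactSpace I]
    {E : Type} [NormedAddCommGroup E] [NormedSpace ℝ E] (n : ℕ∞)
    {F : Type} [NormedAddCommGroup F] [NormedSpace ℝ F] (f : E → F) (hf : ContDiff ℝ n f) :
    ContDiff ℝ n (fun u : C(I, E) => (ContinuousMap.mk f hf.continuous).comp u) := by
  rw [contDiff_iff_forall_nat_le]
  intro m hm
  exact nemytskii_contDiff_nat m f (hf.of_le (by exact_mod_cast hm))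

/-- inverse function theorem on open sets -/
theorem inverse_open {A : Type} [NormedAddCommGroup A] [NormedSpace ℝ A] [CompleteSpace A]
    (r : ℕ∞) (hr : 1 ≤ r) (S : Set A) (hS : IsOpen S) (f : A → A) (hf : ContDiffOn ℝ r f S)
    (a : A) (ha : a ∈ S) (f' : A ≃L[ℝ] A) (hf' : HasFDerivAt f (f' : A →L[ℝ] A) a) :
    ∃ e : OpenPartialHomeomorph A A, a ∈ e.source ∧ e.source ⊆ S ∧ (∀ x, e x = f x) ∧
      ContDiffOn ℝ r e.symm e.target := by
  have hr1 : (1 : WithTop ℕ∞) ≤ r := by exact_mod_cast hr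
  have hr0 : (r : WithTop ℕ∞) ≠ 0 := by
    intro h; rw [h] at hr1; simp at hr1
  have hfa : ContDiffAt ℝ r f a := hf.contDiffAt (hS.mem_nhds ha)
  let e0 := hfa.toOpenPartialHomeomorph f hf' hr0
  have hcont : ContinuousOn (fderiv ℝ f) S := hf.continuousOn_fderiv_of_isOpen hS hr1
  let T := S ∩ fderiv ℝ f ⁻¹' (range ((↑) : (A ≃L[ℝ] A) → A →L[ℝ] A))
  have hT : IsOpen T := hcont.isOpen_inter_preimage hS (ContinuousLinearEquiv.isOpen)
  have haT : a ∈ T := ⟨ha, f', hf'.fderiv.symm⟩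
  let e := e0.restrOpen T hT
  have hes : e.source = e0.source ∩ T := e0.restrOpen_source T hT
  have hef : ∀ x, e x = f x := fun x => rfl
  refine ⟨e, ?_, ?_, hef, ?_⟩
  · rw [hes]; exact ⟨hfa.mem_toOpenPartialHomeomorph_source hf' hr0, haT⟩
  · rw [hes]; exact fun x hx => hx.2.1
  · intro y hy
    have hx : e.symm y ∈ e.source := e.map_target hy
    rw [hes] at hx
    obtain ⟨L, hL⟩ := hx.2.2
    have hc : ContDiffAt ℝ r f (e.symm y) := hf.contDiffAt (hS.mem_nhds hx.2.1)
    refine (e.contDiffAt_symm hy (f₀' := L) ?_ hc).contDiffWithinAt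
    rw [hL]
    exact (hc.differentiableAt (by exact hr0)).hasFDerivAt

theorem unit_zero_mem : (0 : ℝ) ∈ Icc (-1 : ℝ) 1 := by constructor <;> norm_num
theorem unit_one_mem : (1 : ℝ) ∈ Icc (-1 : ℝ) 1 := by constructor <;> norm_num

/-- extension of a curve on `[-1,1]` to the line -/
noncomputable def ext1 {E : Type} [NormedAddCommGroup E] (u : C(Icc (-1 : ℝ) 1, E)) : ℝ → E :=
  IccExtend (by norm_num : (-1 : ℝ) ≤ 1) u

theorem ext1_continuous {E : Type} [NormedAddCommGroup E] (u : C(Icc (-1 : ℝ) 1, E)) :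
    Continuous (ext1 u) := u.continuous.Icc_extend'

theorem ext1_of_mem {E : Type} [NormedAddCommGroup E] (u : C(Icc (-1 : ℝ) 1, E)) {t : ℝ}
    (ht : t ∈ Icc (-1 : ℝ) 1) : ext1 u t = u ⟨t, ht⟩ := IccExtend_of_mem _ _ ht

theorem ext1_norm_le {E : Type} [NormedAddCommGroup E] (u : C(Icc (-1 : ℝ) 1, E)) (t : ℝ) :
    ‖ext1 u t‖ ≤ ‖u‖ := u.norm_coe_le_norm _

/-- integration from `0` as a bounded operator -/
noncomputable def primOp {E : Type} [NormedAddCommGroup E] [NormedSpace ℝ E] [CompleteSpace E] :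
    C(Icc (-1 : ℝ) 1, E) →L[ℝ] C(Icc (-1 : ℝ) 1, E) :=
  LinearMap.mkContinuous
    { toFun := fun w => ⟨fun t => ∫ s in (0 : ℝ)..t, ext1 w s,
        (intervalIntegral.continuous_primitive
          (fun a b => (ext1_continuous w).intervalIntegrable a b) 0).comp continuous_subtype_val⟩
      map_add' := fun v w => by
        ext t
        exact intervalIntegral.integral_add ((ext1_continuous v).intervalIntegrable _ _)
          ((ext1_continuous w).intervalIntegrable _ _)
      map_smul' := fun c v => by
        ext t
        exact intervalIntegral.integral_smul c (ext1 v) } 1 (fun w => by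
      rw [ContinuousMap.norm_le _ (by positivity)]
      intro t
      have h := intervalIntegral.norm_integral_le_of_norm_le_const (a := (0 : ℝ)) (b := t)
        (f := ext1 w) (C := ‖w‖) (fun s _ => ext1_norm_le w s)
      have ht : |(t : ℝ) - 0| ≤ 1 := by
        rw [sub_zero]; exact abs_le.2 t.2
      calc _ ≤ _ := h
        _ ≤ ‖w‖ * 1 := by gcongr
        _ = 1 * ‖w‖ := by ring)

theorem primOp_apply {E : Type} [NormedAddCommGroup E] [NormedSpace ℝ E] [CompleteSpace E]
    (w : C(Icc (-1 : ℝ) 1, E)) (t : Icc (-1 : ℝ) 1) :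
    primOp w t = ∫ s in (0 : ℝ)..t, ext1 w s := rfl

/-- constants as a bounded operator -/
noncomputable def constOp {E : Type} [NormedAddCommGroup E] [NormedSpace ℝ E] :
    E →L[ℝ] C(Icc (-1 : ℝ) 1, E) :=
  LinearMap.mkContinuous
    { toFun := fun x => ContinuousMap.const _ x
      map_add' := fun v w => by ext t; rfl
      map_smul' := fun c v => by ext t; rfl } 1 (fun w => by
      rw [ContinuousMap.norm_le _ (by positivity)]
      intro t
      simp)

theorem constOp_apply {E : Type} [NormedAddCommGroup E] [NormedSpace ℝ E] (x : E)
    (t : Icc (-1 : ℝ) 1) : constOp x t = x := rfl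

/-- rescaling of `[-1,1]` -/
def scaleMap (l : ℝ) (hl : |l| ≤ 1) : C(Icc (-1 : ℝ) 1, Icc (-1 : ℝ) 1) :=
  ⟨fun t => ⟨l * t, abs_le.1 (by
    rw [abs_mul]; exact mul_le_one₀ hl (abs_nonneg _) (abs_le.2 t.2))⟩, by fun_prop⟩

theorem scale_prim {E : Type} [NormedAddCommGroup E] [NormedSpace ℝ E] [CompleteSpace E]
    (w : C(Icc (-1 : ℝ) 1, E)) (l : ℝ) (hl : |l| ≤ 1) (t : Icc (-1 : ℝ) 1) :
    l • primOp (w.comp (scaleMap l hl)) t = primOp w (scaleMap l hl t) := by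
  rw [primOp_apply, primOp_apply]
  have h : ∫ s in (0 : ℝ)..t, ext1 (w.comp (scaleMap l hl)) s
      = ∫ s in (0 : ℝ)..t, ext1 w (l * s) := by
    apply intervalIntegral.integral_congr
    intro s hs
    have hs1 : s ∈ Icc (-1 : ℝ) 1 := by
      exact uIcc_subset_Icc unit_zero_mem t.2 hs
    have hs2 : l * s ∈ Icc (-1 : ℝ) 1 := (scaleMap l hl ⟨s, hs1⟩).2
    change ext1 (w.comp (scaleMap l hl)) s = ext1 w (l * s)
    rw [ext1_of_mem _ hs1, ext1_of_mem _ hs2]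
    rfl
  rw [h, intervalIntegral.smul_integral_comp_mul_left, mul_zero]
  rfl

open Topology in
theorem exists_flow {E : Type} [NormedAddCommGroup E] [NormedSpace ℝ E] [CompleteSpace E]
    (r : ℕ∞) (hr : 1 ≤ r) (F : E → E) (hF : ContDiff ℝ r F) (x₀ : E) :
    ∃ (N : Set (ℝ × E)) (φ : ℝ × E → E), IsOpen N ∧ (0, x₀) ∈ N ∧ ContDiffOn ℝ r φ N ∧
      (∀ x, (0, x) ∈ N → φ (0, x) = x) ∧
      ∀ s x, (s, x) ∈ N → HasDerivAt (fun t => φ (t, x)) (F (φ (s, x))) s := by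
  have hr1 : (1 : WithTop ℕ∞) ≤ r := by exact_mod_cast hr
  let X := C(Icc (-1 : ℝ) 1, E)
  let NF : X → X := fun u => (ContinuousMap.mk F hF.continuous).comp u
  have hNF : ContDiff ℝ r NF := nemytskii_contDiff r F hF
  let G : ℝ × E × X → X := fun z => z.2.2 - constOp z.2.1 - z.1 • primOp (NF z.2.2)
  have hJ : ContDiff ℝ r (fun u : X => primOp (NF u)) :=
    (primOp (E := E)).contDiff.comp hNF
  have hJ2 : ContDiff ℝ r (fun z : ℝ × E × X => primOp (NF z.2.2)) :=
    hJ.comp (contDiff_snd.comp contDiff_snd)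
  have hC : ContDiff ℝ r (fun z : ℝ × E × X => constOp z.2.1) :=
    (constOp (E := E)).contDiff.comp (contDiff_fst.comp contDiff_snd)
  have hG : ContDiff ℝ r G :=
    ((contDiff_snd.comp contDiff_snd).sub hC).sub (contDiff_fst.smul hJ2)
  let Ψ : ℝ × E × X → ℝ × E × X := fun z => (z.1, z.2.1, G z)
  have hΨ : ContDiff ℝ r Ψ := contDiff_fst.prodMk ((contDiff_fst.comp contDiff_snd).prodMk hG)
  let c₀ : X := constOp x₀
  let a : ℝ × E × X := (0, x₀, c₀)
  let k : X := primOp (NF c₀)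
  let π₁ : ℝ × E × X →L[ℝ] ℝ := ContinuousLinearMap.fst ℝ ℝ (E × X)
  let π₂ : ℝ × E × X →L[ℝ] E :=
    (ContinuousLinearMap.fst ℝ E X).comp (ContinuousLinearMap.snd ℝ ℝ (E × X))
  let π₃ : ℝ × E × X →L[ℝ] X :=
    (ContinuousLinearMap.snd ℝ E X).comp (ContinuousLinearMap.snd ℝ ℝ (E × X))
  let A : ℝ × E × X →L[ℝ] ℝ × E × X :=
    π₁.prod (π₂.prod (π₃ - constOp.comp π₂ - π₁.smulRight k))
  let B : ℝ × E × X →L[ℝ] ℝ × E × X :=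
    π₁.prod (π₂.prod (π₃ + constOp.comp π₂ + π₁.smulRight k))
  let Ae : (ℝ × E × X) ≃L[ℝ] (ℝ × E × X) := ContinuousLinearEquiv.equivOfInverse A B
    (fun z => by
      refine Prod.ext rfl (Prod.ext rfl ?_)
      change (z.2.2 - constOp z.2.1 - z.1 • k) + constOp z.2.1 + z.1 • k = z.2.2
      abel)
    (fun z => by
      refine Prod.ext rfl (Prod.ext rfl ?_)
      change (z.2.2 + constOp z.2.1 + z.1 • k) - constOp z.2.1 - z.1 • k = z.2.2
      abel)
  have hderiv : HasFDerivAt Ψ (Ae : (ℝ × E × X) →L[ℝ] (ℝ × E × X)) a := by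
    have h3 : HasFDerivAt G (π₃ - constOp.comp π₂ - π₁.smulRight k) a := by
      have hd : HasFDerivAt (fun z : ℝ × E × X => primOp (NF z.2.2))
          (fderiv ℝ (fun z : ℝ × E × X => primOp (NF z.2.2)) a) a :=
        ((hJ2.differentiable (by
          intro h; rw [h] at hr1; simp at hr1)) a).hasFDerivAt
      have := ((π₃.hasFDerivAt (x := a)).sub ((constOp.comp π₂).hasFDerivAt (x := a))).sub
        ((π₁.hasFDerivAt (x := a)).smul hd)
      refine this.congr_fderiv ?_
      have h0 : π₁ a = 0 := rfl
      rw [h0, zero_smul, zero_add]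
    exact (π₁.hasFDerivAt (x := a)).prodMk ((π₂.hasFDerivAt (x := a)).prodMk h3)
  obtain ⟨e, hae, -, heΨ, hes⟩ := inverse_open r hr univ isOpen_univ Ψ hΨ.contDiffOn a
    (mem_univ _) Ae hderiv
  have hGa : G a = 0 := by
    change c₀ - constOp x₀ - (0 : ℝ) • primOp (NF c₀) = 0
    simp [c₀]
  have hΨa : Ψ a = (0, x₀, 0) := by
    change (0, x₀, G a) = _
    rw [hGa]
  have hat : ((0 : ℝ), x₀, (0 : X)) ∈ e.target := by
    rw [← hΨa, ← heΨ]; exact e.map_source hae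
  obtain ⟨δ, hδ, hball⟩ := Metric.isOpen_iff.1 e.open_source a hae
  let ι : ℝ × E → ℝ × E × X := fun z => (z.1, z.2, 0)
  have hι : ContDiff ℝ r ι := contDiff_fst.prodMk (contDiff_snd.prodMk contDiff_const)
  let ψ : ℝ × E → X := fun z => (e.symm (ι z)).2.2
  have hψa : ψ (0, x₀) = c₀ := by
    change (e.symm (0, x₀, 0)).2.2 = c₀
    rw [← hΨa, ← heΨ, e.left_inv hae]
  let M : Set (ℝ × E) := ι ⁻¹' e.target
  have hM : IsOpen M := e.open_target.preimage hι.continuous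
  have hψ : ContDiffOn ℝ r ψ M :=
    (contDiff_snd.comp contDiff_snd).comp_contDiffOn
      (hes.comp hι.contDiffOn (fun z hz => hz))
  have hψG : ∀ z ∈ M, ψ z = constOp z.2 + z.1 • primOp (NF (ψ z)) := by
    intro z hz
    have h := e.right_inv (show ι z ∈ e.target from hz)
    rw [heΨ] at h
    have h1 : (e.symm (ι z)).1 = z.1 := congrArg Prod.fst h
    have h2 : (e.symm (ι z)).2.1 = z.2 := congrArg (fun q => q.2.1) h
    have h3 : G (e.symm (ι z)) = 0 := congrArg (fun q => q.2.2) h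
    have h4 : ψ z - constOp (e.symm (ι z)).2.1 - (e.symm (ι z)).1 • primOp (NF (ψ z)) = 0 := h3
    rw [h1, h2, sub_sub, sub_eq_zero] at h4
    exact h4
  have hψGp : ∀ z ∈ M, ∀ t, ψ z t = z.2 + z.1 • primOp (NF (ψ z)) t := fun z hz t =>
    congrArg (fun w : X => w t) (hψG z hz)
  have hN1 : {z | z ∈ M ∧ ψ z ∈ Metric.ball c₀ δ} ∈ 𝓝 ((0 : ℝ), x₀) := by
    have hMn : M ∈ 𝓝 ((0 : ℝ), x₀) := hM.mem_nhds hat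
    refine Filter.inter_mem hMn ?_
    exact (hψ.continuousOn.continuousAt hMn).preimage_mem_nhds (by
      rw [hψa]; exact Metric.ball_mem_nhds _ hδ)
  obtain ⟨ε₀, hε₀, hε₀'⟩ := Metric.mem_nhds_iff.1 hN1
  let ε := min ε₀ δ
  have hε : 0 < ε := lt_min hε₀ hδ
  have hin : ∀ z ∈ Metric.ball ((0 : ℝ), x₀) ε, z ∈ M ∧ ψ z ∈ Metric.ball c₀ δ := fun z hz =>
    hε₀' (Metric.ball_subset_ball (min_le_left _ _) hz)
  have hmem : ∀ s x, (s, x) ∈ Metric.ball ((0 : ℝ), x₀) ε ↔ |s| < ε ∧ dist x x₀ < ε := by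
    intro s x
    rw [Metric.mem_ball, Prod.dist_eq, max_lt_iff, Real.dist_eq, sub_zero]
  -- the scaling identity
  have hscale : ∀ s₁ x l (hl : |l| ≤ 1), (s₁, x) ∈ Metric.ball ((0 : ℝ), x₀) ε →
      ψ (l * s₁, x) = (ψ (s₁, x)).comp (scaleMap l hl) := by
    intro s₁ x l hl hz
    obtain ⟨hzM, hzψ⟩ := hin _ hz
    rw [hmem] at hz
    set v : X := (ψ (s₁, x)).comp (scaleMap l hl) with hv
    have hls : |l * s₁| < ε := by
      rw [abs_mul]
      exact lt_of_le_of_lt (mul_le_of_le_one_left (abs_nonneg _) hl) hz.1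
    have hvb : dist v c₀ < δ := by
      rw [ContinuousMap.dist_lt_iff hδ]
      intro t
      exact lt_of_le_of_lt (ContinuousMap.dist_apply_le_dist (f := ψ (s₁, x)) (g := c₀) (scaleMap l hl t)) hzψ
    have hsrc : (l * s₁, x, v) ∈ e.source := by
      apply hball
      rw [Metric.mem_ball, Prod.dist_eq, Prod.dist_eq, max_lt_iff, max_lt_iff]
      refine ⟨?_, hz.2.trans_le (min_le_right _ _), hvb⟩
      change dist (l * s₁) 0 < δ
      rw [Real.dist_eq, sub_zero]
      exact hls.trans_le (min_le_right _ _)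
    have hG0 : G (l * s₁, x, v) = 0 := by
      ext t
      have h1 := hψGp _ hzM (scaleMap l hl t)
      rw [← scale_prim] at h1
      change v t - x - (l * s₁) • primOp (NF v) t = 0
      have h2 : v t = x + s₁ • l • primOp ((NF (ψ (s₁, x))).comp (scaleMap l hl)) t := h1
      have h3 : NF v = (NF (ψ (s₁, x))).comp (scaleMap l hl) := rfl
      rw [h2, h3, smul_smul, mul_comm s₁ l]
      abel
    have hfin : e.symm (ι (l * s₁, x)) = (l * s₁, x, v) := by
      have : ι (l * s₁, x) = e (l * s₁, x, v) := by
        rw [heΨ]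
        change (l * s₁, x, (0 : X)) = (l * s₁, x, G (l * s₁, x, v))
        rw [hG0]
      rw [this, e.left_inv hsrc]
    change (e.symm (ι (l * s₁, x))).2.2 = v
    rw [hfin]
  let φ : ℝ × E → E := fun z => ψ z ⟨1, unit_one_mem⟩
  refine ⟨Metric.ball ((0 : ℝ), x₀) ε, φ, Metric.isOpen_ball, Metric.mem_ball_self hε, ?_, ?_, ?_⟩
  · have h1 : ContDiff ℝ r (fun u : X => u ⟨1, unit_one_mem⟩) :=
      ContinuousLinearMap.contDiff (E := X) (F := E)
        (ContinuousMap.evalCLM ℝ (⟨1, unit_one_mem⟩ : Icc (-1 : ℝ) 1))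
    exact h1.comp_contDiffOn (hψ.mono fun z hz => (hin z hz).1)
  · intro x hx
    change ψ (0, x) ⟨1, unit_one_mem⟩ = x
    rw [hψGp _ (hin _ hx).1, zero_smul, add_zero]
  · intro s x hsx
    have hsx' := (hmem s x).1 hsx
    obtain ⟨s₁, hs1, hs2⟩ := exists_between hsx'.1
    have hs₁ : 0 < s₁ := lt_of_le_of_lt (abs_nonneg _) hs1
    have hz1 : (s₁, x) ∈ Metric.ball ((0 : ℝ), x₀) ε :=
      (hmem _ _).2 ⟨by rwa [abs_of_pos hs₁], hsx'.2⟩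
    have key : ∀ t, |t| ≤ s₁ → φ (t, x) = ext1 (ψ (s₁, x)) (t / s₁) ∧
        φ (t, x) = x + s₁ • ∫ τ in (0 : ℝ)..(t / s₁), ext1 (NF (ψ (s₁, x))) τ := by
      intro t ht
      have hl : |t / s₁| ≤ 1 := by
        rw [abs_div, abs_of_pos hs₁, div_le_one hs₁]; exact ht
      have h1 := hscale s₁ x (t / s₁) hl hz1
      rw [div_mul_cancel₀ _ hs₁.ne'] at h1
      have h2 : φ (t, x) = ψ (s₁, x) (scaleMap (t / s₁) hl ⟨1, unit_one_mem⟩) := by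
        change ψ (t, x) _ = _
        rw [h1]; rfl
      have h3 : scaleMap (t / s₁) hl ⟨1, unit_one_mem⟩ = ⟨t / s₁, abs_le.1 hl⟩ :=
        Subtype.ext (mul_one _)
      rw [h3] at h2
      refine ⟨by rw [h2, ext1_of_mem _ (abs_le.1 hl)], ?_⟩
      rw [h2, hψGp _ (hin _ hz1).1]
      rfl
    have hFφ : ext1 (NF (ψ (s₁, x))) (s / s₁) = F (φ (s, x)) := by
      rw [(key s hs1.le).1]; rfl
    have hc := ext1_continuous (NF (ψ (s₁, x)))
    have hd1 : HasDerivAt (fun t : ℝ => x + s₁ • ∫ τ in (0 : ℝ)..(t / s₁),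
        ext1 (NF (ψ (s₁, x))) τ) (s₁ • ((1 / s₁) • ext1 (NF (ψ (s₁, x))) (s / s₁))) s := by
      have hi := intervalIntegral.integral_hasDerivAt_right (hc.intervalIntegrable 0 (s / s₁))
        hc.stronglyMeasurable.stronglyMeasurableAtFilter hc.continuousAt
      have hdiv : HasDerivAt (fun t : ℝ => t / s₁) (1 / s₁) s := (hasDerivAt_id s).div_const s₁
      exact ((hi.scomp s hdiv).const_smul s₁).const_add x
    rw [smul_smul, mul_one_div_cancel hs₁.ne', one_smul, hFφ] at hd1
    refine hd1.congr_of_eventuallyEq ?_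
    have : {t : ℝ | |t| < s₁} ∈ 𝓝 s := (isOpen_lt continuous_abs continuous_const).mem_nhds hs1
    filter_upwards [this] with t ht
    exact (key t (le_of_lt ht)).2

theorem pd_contDiffOn {n : ℕ} {k m : WithTop ℕ∞} {V : Set (Fin n → ℝ)} (hV : IsOpen V)
    {φ : (Fin n → ℝ) → ℝ} (hφ : ContDiffOn ℝ k φ V) (hm : m + 1 ≤ k) (i : Fin n) :
    ContDiffOn ℝ m (pd i φ) V :=
  (hφ.fderiv_of_isOpen hV hm).clm_apply contDiffOn_const

theorem coe_sub_two (m : ℕ∞) : ((m + 2 : ℕ∞) : WithTop ℕ∞) - 2 = m := by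
  have h : ((m + 2 : ℕ∞) : WithTop ℕ∞) - ((2 : ℕ∞) : WithTop ℕ∞) = ((m + 2 - 2 : ℕ∞) : WithTop ℕ∞) :=
    (WithTop.coe_sub).symm
  have h2 : m + 2 - 2 = m := by
    cases m with
    | top => rfl
    | coe k => exact_mod_cast (show k + 2 - 2 = k by omega)
  rw [h2] at h
  exact h

theorem transConn_contDiffOn {n : ℕ} (r : ℕ∞) (hr : 2 ≤ r)
    (Γ : Fin n → Fin n → Fin n → (Fin n → ℝ) → ℝ) (U V : Set (Fin n → ℝ))
    (hU : IsOpen U) (hV : IsOpen V) (f g : (Fin n → ℝ) → (Fin n → ℝ))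
    (hΓ : ∀ h i j, ContDiffOn ℝ r (Γ h i j) U) (hf : ContDiffOn ℝ r f U)
    (hg : ContDiffOn ℝ r g V) (hgm : MapsTo g V U) (h i j : Fin n) :
    ContDiffOn ℝ (r - 2) (transConn Γ f g h i j) V := by
  obtain ⟨m, rfl⟩ := exists_add_of_le hr
  rw [add_comm 2 m] at *
  rw [coe_sub_two]
  have e1 : (m : WithTop ℕ∞) + 1 + 1 ≤ ((m + 2 : ℕ∞) : WithTop ℕ∞) := by
    rw [add_assoc]; exact le_of_eq (by push_cast; norm_num)
  have e2 : (m : WithTop ℕ∞) + 1 ≤ ((m + 2 : ℕ∞) : WithTop ℕ∞) := le_self_add.trans e1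
  have e3 : (m : WithTop ℕ∞) ≤ ((m + 2 : ℕ∞) : WithTop ℕ∞) := le_self_add.trans e2
  have hgc : ∀ α, ContDiffOn ℝ ((m + 2 : ℕ∞) : WithTop ℕ∞) (fun y => g y α) V :=
    fun α => contDiffOn_pi.1 hg α
  have hfc : ∀ α, ContDiffOn ℝ ((m + 2 : ℕ∞) : WithTop ℕ∞) (fun y => f y α) U :=
    fun α => contDiffOn_pi.1 hf α
  unfold transConn
  refine ContDiffOn.sum fun γ _ => ContDiffOn.mul (ContDiffOn.add ?_ ?_) ?_
  · refine ContDiffOn.sum fun α _ => ContDiffOn.sum fun β _ => ContDiffOn.mul (ContDiffOn.mul ?_ ?_) ?_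
    · exact ((hΓ γ α β).of_le e3).comp (hg.of_le e3) hgm
    · exact pd_contDiffOn hV (hgc α) e2 i
    · exact pd_contDiffOn hV (hgc β) e2 j
  · exact pd_contDiffOn hV (pd_contDiffOn hV (hgc γ) e1 j) le_rfl i
  · exact (pd_contDiffOn hU (hfc h) e2 γ).comp (hg.of_le e3) hgm

theorem exists_global_extension {n : ℕ} (r : ℕ∞)
    (U : Set (Fin n → ℝ)) (hU : IsOpen U) (p : Fin n → ℝ) (hp : p ∈ U)
    (Γ : Fin n → Fin n → Fin n → (Fin n → ℝ) → ℝ)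
    (hΓ : ∀ h i j, ContDiffOn ℝ r (Γ h i j) U) :
    ∃ (Γ' : Fin n → Fin n → Fin n → (Fin n → ℝ) → ℝ) (W : Set (Fin n → ℝ)),
      IsOpen W ∧ p ∈ W ∧ W ⊆ U ∧ (∀ h i j, ContDiff ℝ r (Γ' h i j)) ∧
      ∀ h i j, ∀ x ∈ W, Γ' h i j x = Γ h i j x := by
  obtain ⟨ε, hε, hb⟩ := Metric.isOpen_iff.1 hU p hp
  let χ : ContDiffBump p := ⟨ε / 4, ε / 2, by positivity, by linarith⟩
  have hsub : tsupport χ ⊆ U := by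
    rw [χ.tsupport_eq]
    exact (Metric.closedBall_subset_ball (by change ε / 2 < ε; linarith)).trans hb
  refine ⟨fun h i j x => χ x * Γ h i j x, Metric.ball p (ε / 4), Metric.isOpen_ball,
    Metric.mem_ball_self (by positivity), ?_, ?_, ?_⟩
  · exact (Metric.ball_subset_ball (by linarith)).trans hb
  · intro h i j
    refine contDiff_iff_contDiffAt.2 fun x => ?_
    by_cases hx : x ∈ tsupport χ
    swap
    · have h0 := notMem_tsupport_iff_eventuallyEq.1 hx
      have h1 : (fun x => χ x * Γ h i j x) =ᶠ[nhds x] fun _ => (0 : ℝ) := by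
        filter_upwards [h0] with y hy
        rw [hy]; simp
      exact contDiffAt_const.congr_of_eventuallyEq h1
    have hxU : x ∈ U := hsub hx
    exact χ.contDiff.contDiffAt.mul ((hΓ h i j).contDiffAt (hU.mem_nhds hxU))
  · intro h i j x hx
    have : χ x = 1 := χ.one_of_mem_closedBall (Metric.ball_subset_closedBall hx)
    simp [this]

/-- Theorem 3 (main theorem): for any affine connection with components of class `Cʳ`,
`r ≥ 2`, there is a local coordinate transformation `f` of class `Cʳ` around any point `p`
after which the transformed components satisfy `Γ′^h_{11} = 0` (pre-semigeodesic
coordinates), and the transformed components are of class `C^{r-2}`. -/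
theorem exists_pre_semigeodesic_coordinates
    (n : ℕ) (hn : 2 ≤ n) (r : ℕ∞) (hr : 2 ≤ r)
    (U : Set (Fin n → ℝ)) (hU : IsOpen U) (p : Fin n → ℝ) (hp : p ∈ U)
    (Γ : Fin n → Fin n → Fin n → (Fin n → ℝ) → ℝ)
    (hΓ : ∀ h i j, ContDiffOn ℝ r (Γ h i j) U) :
    ∃ (U' V : Set (Fin n → ℝ)) (f g : (Fin n → ℝ) → (Fin n → ℝ)),
      IsOpen U' ∧ p ∈ U' ∧ U' ⊆ U ∧ IsOpen V ∧
      Set.BijOn f U' V ∧ (∀ x ∈ U', g (f x) = x) ∧ (∀ y ∈ V, f (g y) = y) ∧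
      ContDiffOn ℝ r f U' ∧ ContDiffOn ℝ r g V ∧
      (∀ x' ∈ V, ∀ h : Fin n, transConn Γ f g h ⟨0, by omega⟩ ⟨0, by omega⟩ x' = 0) ∧
      (∀ h i j, ContDiffOn ℝ (r - 2) (transConn Γ f g h i j) V) := by
  have hr1 : 1 ≤ r := le_trans (by norm_num) hr
  have hr0 : (r : WithTop ℕ∞) ≠ 0 := by
    have : (1 : WithTop ℕ∞) ≤ r := by exact_mod_cast hr1
    intro h; rw [h] at this; simp at this
  obtain ⟨Γ', W, hW, hpW, hWU, hΓ', hΓW⟩ := exists_global_extension r U hU p hp Γ hΓ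
  have hn0 : 0 < n := by omega
  set i0 : Fin n := ⟨0, hn0⟩ with hi0
  let e0 : (Fin n → ℝ) := Pi.single i0 1
  let F : (Fin n → ℝ) × (Fin n → ℝ) → (Fin n → ℝ) × (Fin n → ℝ) := fun z => (z.2, fun γ => -∑ α, ∑ β, Γ' γ α β z.1 * z.2 α * z.2 β)
  have hsnd : ∀ α, ContDiff ℝ r (fun z : (Fin n → ℝ) × (Fin n → ℝ) => z.2 α) := fun α =>
    (contDiff_apply ℝ ℝ α).comp contDiff_snd
  have hF : ContDiff ℝ r F := by
    refine contDiff_snd.prodMk (contDiff_pi.2 fun γ => ContDiff.neg ?_)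
    exact ContDiff.sum fun α _ => ContDiff.sum fun β _ =>
      (((hΓ' γ α β).comp contDiff_fst).mul (hsnd α)).mul (hsnd β)
  obtain ⟨N, φ, hN, h0N, hφ, hφ0, hφd⟩ := exists_flow r hr1 F hF (p, e0)
  let Q : (Fin n → ℝ) → ℝ × ((Fin n → ℝ) × (Fin n → ℝ)) := fun y => (y i0, (p + (y - y i0 • e0), e0))
  have hQ : ContDiff ℝ r Q := by
    have h1 : ContDiff ℝ r (fun y : (Fin n → ℝ) => y i0) := contDiff_apply ℝ ℝ i0
    exact h1.prodMk ((contDiff_const.add (contDiff_id.sub (h1.smul contDiff_const))).prodMk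
      contDiff_const)
  let Φ : (Fin n → ℝ) → (Fin n → ℝ) × (Fin n → ℝ) := fun y => φ (Q y)
  let S₁ : Set (Fin n → ℝ) := Q ⁻¹' N
  have hS₁ : IsOpen S₁ := hN.preimage hQ.continuous
  have hΦ : ContDiffOn ℝ r Φ S₁ := hφ.comp hQ.contDiffOn (fun y hy => hy)
  have hQ0 : Q 0 = (0, (p, e0)) := by simp [Q]
  have h0S₁ : (0 : (Fin n → ℝ)) ∈ S₁ := by
    change Q 0 ∈ N
    rw [hQ0]; exact h0N
  have hΦd : ∀ y ∈ S₁, HasFDerivAt Φ (fderiv ℝ Φ y) y := fun y hy =>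
    ((hΦ.contDiffAt (hS₁.mem_nhds hy)).differentiableAt hr0).hasFDerivAt
  have hee : e0 i0 = 1 := Pi.single_eq_same i0 1
  have hQt : ∀ y t, Q (y + t • e0) = (y i0 + t, (Q y).2) := by
    intro y t
    refine Prod.ext ?_ (Prod.ext ?_ rfl)
    · simp [Q, hee]
    · change p + ((y + t • e0) - (y + t • e0) i0 • e0) = p + (y - y i0 • e0)
      have : (y + t • e0) i0 = y i0 + t := by simp [hee]
      rw [this, add_smul]; abel
  -- derivative in the first direction
  have hdir : ∀ y ∈ S₁, fderiv ℝ Φ y e0 = F (Φ y) := by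
    intro y hy
    have h1 : HasDerivAt (fun t : ℝ => Φ (y + t • e0)) (fderiv ℝ Φ y e0) 0 :=
      (hΦd y hy).hasLineDerivAt e0
    have h2 := hφd (y i0) (Q y).2 hy
    have h3 : HasDerivAt (fun t : ℝ => φ (y i0 + t, (Q y).2)) (F (Φ y)) 0 := by
      have h2' : HasDerivAt (fun t => φ (t, (Q y).2)) (F (Φ y)) (y i0 + 0) := by
        rw [add_zero]; exact h2
      exact h2'.comp_const_add (y i0) 0
    have h4 : (fun t : ℝ => Φ (y + t • e0)) = fun t : ℝ => φ (y i0 + t, (Q y).2) := by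
      funext t
      change φ (Q (y + t • e0)) = _
      rw [hQt]
    rw [h4] at h1
    exact h1.unique h3
  have hpd : ∀ (L : (Fin n → ℝ) × (Fin n → ℝ) →L[ℝ] ℝ), ∀ y ∈ S₁, pd i0 (fun z => L (Φ z)) y = L (F (Φ y)) := by
    intro L y hy
    have h1 : HasFDerivAt (fun z => L (Φ z)) (L.comp (fderiv ℝ Φ y)) y :=
      L.hasFDerivAt.comp y (hΦd y hy)
    unfold pd
    rw [h1.fderiv]
    change L (fderiv ℝ Φ y e0) = _
    rw [hdir y hy]
  let g : (Fin n → ℝ) → (Fin n → ℝ) := fun y => (Φ y).1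
  have hg : ContDiffOn ℝ r g S₁ := contDiff_fst.comp_contDiffOn hΦ
  have hΦ0 : Φ 0 = (p, e0) := by
    change φ (Q 0) = _
    rw [hQ0]; exact hφ0 _ h0N
  have hg0 : g 0 = p := by
    change (Φ 0).1 = p
    rw [hΦ0]
  let S : Set (Fin n → ℝ) := S₁ ∩ g ⁻¹' W
  have hS : IsOpen S := hg.continuousOn.isOpen_inter_preimage hS₁ hW
  have h0S : (0 : (Fin n → ℝ)) ∈ S := ⟨h0S₁, by change g 0 ∈ W; rw [hg0]; exact hpW⟩
  have hgd : HasFDerivAt g ((ContinuousLinearEquiv.refl ℝ (Fin n → ℝ) : (Fin n → ℝ) ≃L[ℝ] (Fin n → ℝ)) : (Fin n → ℝ) →L[ℝ] (Fin n → ℝ)) 0 := by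
    have h1 : HasFDerivAt g ((ContinuousLinearMap.fst ℝ (Fin n → ℝ) (Fin n → ℝ)).comp (fderiv ℝ Φ 0)) 0 :=
      (ContinuousLinearMap.fst ℝ (Fin n → ℝ) (Fin n → ℝ)).hasFDerivAt.comp (0 : (Fin n → ℝ)) (hΦd 0 h0S₁)
    refine h1.congr_fderiv ?_
    ext1 w
    change (fderiv ℝ Φ 0 w).1 = w
    have hw : w = w i0 • e0 + (w - w i0 • e0) := by abel
    set w' := w - w i0 • e0 with hw'
    have hw0 : w' i0 = 0 := by simp [hw', hee]
    have hd' : fderiv ℝ Φ 0 w' = (w', 0) := by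
      have h2 : HasDerivAt (fun t : ℝ => Φ (0 + t • w')) (fderiv ℝ Φ 0 w') 0 :=
        (hΦd 0 h0S₁).hasLineDerivAt w'
      have hev : (fun t : ℝ => Φ (0 + t • w')) =ᶠ[nhds 0] fun t => (p + t • w', e0) := by
        have hc : ContinuousAt (fun t : ℝ => (0 : (Fin n → ℝ)) + t • w') 0 := by fun_prop
        have hm : S₁ ∈ nhds ((0 : (Fin n → ℝ)) + (0 : ℝ) • w') := by
          rw [zero_smul, add_zero]; exact hS₁.mem_nhds h0S₁
        filter_upwards [hc.preimage_mem_nhds hm] with t ht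
        have hq : Q (0 + t • w') = (0, (p + t • w', e0)) := by
          simp [Q, hw0]
        have ht' : Q (0 + t • w') ∈ N := ht
        change φ (Q (0 + t • w')) = _
        rw [hq] at ht' ⊢
        exact hφ0 _ ht'
      have h3 : HasDerivAt (fun t : ℝ => (p + t • w', e0)) (w', (0 : (Fin n → ℝ))) 0 := by
        have h4 : HasDerivAt (fun t : ℝ => p + t • w') w' 0 := by
          simpa using ((hasDerivAt_id (0 : ℝ)).smul_const w').const_add p
        exact h4.prodMk (hasDerivAt_const _ _)
      exact (h2.congr_of_eventuallyEq hev.symm).unique h3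
    conv_lhs => rw [hw]
    rw [map_add, map_smul, hdir 0 h0S₁, hd', hΦ0]
    change w i0 • e0 + w' = w
    exact hw.symm
  obtain ⟨e, hae, heS, heg, hes⟩ := inverse_open r hr1 S hS g (hg.mono inter_subset_left) 0 h0S
    (ContinuousLinearEquiv.refl ℝ (Fin n → ℝ)) hgd
  have hgm : ∀ y ∈ e.source, g y ∈ e.target := fun y hy => by
    rw [← heg]; exact e.map_source hy
  have htU : e.target ⊆ U := by
    intro x hx
    have h1 := (heS (e.map_target hx)).2
    have h2 : g (e.symm x) = x := by rw [← heg]; exact e.right_inv hx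
    have h3 : g (e.symm x) ∈ W := h1
    rw [h2] at h3
    exact hWU h3
  have hgV : ContDiffOn ℝ r g e.source := hg.mono fun y hy => (heS hy).1
  refine ⟨e.target, e.source, e.symm, g, e.open_target, ?_, htU, e.open_source,
    e.symm.bijOn, ?_, ?_, hes, hgV, ?_, ?_⟩
  · rw [← hg0]; exact hgm 0 hae
  · intro x hx; rw [← heg]; exact e.right_inv hx
  · intro y hy; rw [← heg]; exact e.left_inv hy
  · intro x hx h
    have hxS := heS hx
    change transConn Γ e.symm g h i0 i0 x = 0
    let L1 : Fin n → ((Fin n → ℝ) × (Fin n → ℝ) →L[ℝ] ℝ) := fun α =>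
      (ContinuousLinearMap.proj (R := ℝ) (φ := fun _ : Fin n => ℝ) α).comp
        (ContinuousLinearMap.fst ℝ (Fin n → ℝ) (Fin n → ℝ))
    let L2 : Fin n → ((Fin n → ℝ) × (Fin n → ℝ) →L[ℝ] ℝ) := fun α =>
      (ContinuousLinearMap.proj (R := ℝ) (φ := fun _ : Fin n => ℝ) α).comp
        (ContinuousLinearMap.snd ℝ (Fin n → ℝ) (Fin n → ℝ))
    have hp1 : ∀ α, ∀ y ∈ S₁, pd i0 (fun z => g z α) y = (Φ y).2 α := fun α y hy =>
      hpd (L1 α) y hy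
    have hp2 : ∀ α, pd i0 (fun y => pd i0 (fun z => g z α) y) x
        = -∑ β, ∑ γ, Γ' α β γ (g x) * (Φ x).2 β * (Φ x).2 γ := by
      intro α
      have hev : (fun y => pd i0 (fun z => g z α) y) =ᶠ[nhds x] fun y => L2 α (Φ y) := by
        filter_upwards [hS₁.mem_nhds hxS.1] with y hy
        exact hp1 α y hy
      have h1 : pd i0 (fun y => pd i0 (fun z => g z α) y) x = pd i0 (fun y => L2 α (Φ y)) x := by
        unfold pd at hev ⊢
        rw [hev.fderiv_eq]
      rw [h1, hpd (L2 α) x hxS.1]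
      rfl
    unfold transConn
    refine Finset.sum_eq_zero fun γ _ => ?_
    rw [hp2 γ]
    simp only [hp1 _ x hxS.1, hΓW _ _ _ (g x) hxS.2]
    rw [add_neg_cancel, zero_mul]
  · intro h i j
    exact transConn_contDiffOn r hr Γ e.target e.source e.open_target e.open_source e.symm g
      (fun h i j => (hΓ h i j).mono htU) hes hgV hgm h i j
end

section
/- Let n ≥ 2, let r ∈ ℕ ∪ {∞} with r ≥ 2, let U ⊆ ℝⁿ be open, p ∈ U, and let Γ^h_{ij} : U → ℝ be connection components of class Cʳ on U. Then there exist open sets U′ ⊆ U with p ∈ U′ and V ⊆ ℝⁿ, and a bijection f : U′ → V with f and g := f⁻¹ of class Cʳ, such that for every choice of constants a₂,…,aₙ ∈ ℝ and every open interval I with {(τ, a₂,…,aₙ) : τ ∈ I} ⊆ V, the curve c(τ) := g(τ, a₂,…,aₙ) is a geodesic of Γ in natural parameter, i.e. satisfies (d²c^h/dτ²)(τ) + Σ_{i,j} Γ^h_{ij}(c(τ)) (dc^i/dτ)(τ) (dc^j/dτ)(τ) = 0 for all τ ∈ I and all h. -/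
open Set

/-- The coordinate line `ℓ(τ) = (τ, a₂, …, aₙ)`. -/
def coordLine (n : ℕ) (a : Fin n → ℝ) (τ : ℝ) : Fin n → ℝ :=
  fun i => if (i : ℕ) = 0 then τ else a i

/-- The geodesic equation (in natural parameter) for a curve `c` at parameter `τ`,
for the connection with components `Γ`. -/
def IsGeodesicAt (n : ℕ) (Γ : Fin n → Fin n → Fin n → (Fin n → ℝ) → ℝ)
    (c : ℝ → Fin n → ℝ) (τ : ℝ) : Prop :=
  ∀ h : Fin n,
    deriv (fun s => deriv (fun u => c u h) s) τ +
      ∑ i, ∑ j, Γ h i j (c τ) *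
        deriv (fun u => c u i) τ * deriv (fun u => c u j) τ = 0

open Set Topology

noncomputable def nemM (K E F : Type) [TopologicalSpace K] [CompactSpace K]
    [NormedAddCommGroup E] [NormedSpace ℝ E] [NormedAddCommGroup F] [NormedSpace ℝ F] :
    C(K, E →L[ℝ] F) →L[ℝ] C(K, E) →L[ℝ] C(K, F) :=
  LinearMap.mkContinuous₂
    (LinearMap.mk₂ ℝ (fun (A : C(K, E →L[ℝ] F)) (h : C(K, E)) =>
      (⟨fun t => A t (h t), by fun_prop⟩ : C(K, F)))
      (by intros; ext; simp) (by intros; ext; simp) (by intros; ext; simp) (by intros; ext; simp)) 1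
    (by
      intro A h
      rw [ContinuousMap.norm_le _ (by positivity)]
      intro t
      simp only [LinearMap.mk₂_apply, ContinuousMap.coe_mk, one_mul]
      exact (ContinuousLinearMap.le_opNorm _ _).trans
        (mul_le_mul (A.norm_coe_le_norm t) (h.norm_coe_le_norm t) (norm_nonneg _) (norm_nonneg A)))

theorem nemM_apply (K E F : Type) [TopologicalSpace K] [CompactSpace K]
    [NormedAddCommGroup E] [NormedSpace ℝ E] [NormedAddCommGroup F] [NormedSpace ℝ F]
    (A : C(K, E →L[ℝ] F)) (h : C(K, E)) (t : K) : nemM K E F A h t = A t (h t) := rfl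

theorem nem_hasFDerivAt {K E F : Type} [TopologicalSpace K] [CompactSpace K]
    [NormedAddCommGroup E] [NormedSpace ℝ E] [NormedAddCommGroup F] [NormedSpace ℝ F]
    (f : C(E, F)) (f' : C(E, E →L[ℝ] F)) (hf : ∀ x, HasFDerivAt f (f' x) x) (α : C(K, E)) :
    HasFDerivAt (fun β : C(K, E) => f.comp β) (nemM K E F (f'.comp α)) α := by
  rw [hasFDerivAt_iff_isLittleO_nhds_zero, Asymptotics.isLittleO_iff]
  intro ε hε
  have hc : Continuous (fun β : C(K, E) => f'.comp β) := ContinuousMap.continuous_postcomp f'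
  obtain ⟨δ, hδ, H⟩ := (Metric.continuous_iff (α := C(K, E)) (β := C(K, E →L[ℝ] F))).1 hc α ε hε
  filter_upwards [Metric.ball_mem_nhds (0 : C(K, E)) hδ] with h hh
  rw [mem_ball_zero_iff] at hh
  rw [ContinuousMap.norm_le _ (by positivity)]
  intro t
  have key := Convex.norm_image_sub_le_of_norm_hasFDerivWithin_le' (𝕜 := ℝ) (f := f) (f' := f')
    (φ := f' (α t)) (C := ε) (s := segment ℝ (α t) (α t + h t)) (x := α t) (y := α t + h t)
    (fun x _ => (hf x).hasFDerivWithinAt) ?_ (convex_segment _ _) (left_mem_segment _ _ _)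
    (right_mem_segment _ _ _)
  · simp only [ContinuousMap.sub_apply, ContinuousMap.comp_apply, ContinuousMap.add_apply,
      nemM_apply]
    rw [add_sub_cancel_left] at key
    exact key.trans (mul_le_mul_of_nonneg_left (h.norm_coe_le_norm t) hε.le)
  · intro x hx
    rw [segment_eq_image'] at hx
    obtain ⟨s, hs, rfl⟩ := hx
    have h1 : dist (α + s • h) α < δ := by
      rw [dist_eq_norm, add_sub_cancel_left, norm_smul, Real.norm_of_nonneg hs.1]
      exact (mul_le_of_le_one_left (norm_nonneg _) hs.2).trans_lt hh
    have h2 := H _ h1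
    have h3 := (ContinuousMap.dist_apply_le_dist (f := f'.comp (α + s • h))
      (g := f'.comp α) t).trans h2.le
    rw [dist_eq_norm] at h3
    simpa using h3

theorem nem_contDiff_nat {K E : Type} [TopologicalSpace K] [CompactSpace K]
    [NormedAddCommGroup E] [NormedSpace ℝ E] (n : ℕ) :
    ∀ {F : Type} [NormedAddCommGroup F] [NormedSpace ℝ F]
    (f : C(E, F)) (_ : ContDiff ℝ n f), ContDiff ℝ n (fun β : C(K, E) => f.comp β) := by
  induction n with
  | zero =>
    intro F _ _ f _
    exact contDiff_zero.2 (ContinuousMap.continuous_postcomp f)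
  | succ n ih =>
    intro F _ _ f hf
    obtain ⟨f', hf', hd⟩ := contDiff_succ_iff_hasFDerivAt.1 hf
    let g : C(E, E →L[ℝ] F) := ⟨f', hf'.continuous⟩
    refine contDiff_succ_iff_hasFDerivAt.2 ⟨fun α => nemM K E F (g.comp α), ?_, ?_⟩
    · exact (nemM K E F).contDiff.comp (ih g hf')
    · exact fun α => nem_hasFDerivAt f g hd α

theorem nem_contDiff {K E F : Type} [TopologicalSpace K] [CompactSpace K]
    [NormedAddCommGroup E] [NormedSpace ℝ E] [NormedAddCommGroup F] [NormedSpace ℝ F]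
    (r : ℕ∞) (f : C(E, F)) (hf : ContDiff ℝ r f) :
    ContDiff ℝ r (fun β : C(K, E) => f.comp β) := by
  rw [contDiff_iff_forall_nat_le] at hf ⊢
  exact fun m hm => nem_contDiff_nat m f (hf m hm)

/-- Inverse function theorem with a smooth inverse on an open set. -/
theorem invFun_contDiffOn {E F : Type} [NormedAddCommGroup E] [NormedSpace ℝ E] [CompleteSpace E]
    [NormedAddCommGroup F] [NormedSpace ℝ F] (r : ℕ∞) (hr : 1 ≤ r)
    (f : E → F) (W : Set E) (hW : IsOpen W) (hf : ContDiffOn ℝ r f W) (a : E) (ha : a ∈ W)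
    (f' : E ≃L[ℝ] F) (hf' : HasFDerivAt f (f' : E →L[ℝ] F) a) :
    ∃ e : OpenPartialHomeomorph E F, (e : E → F) = f ∧ a ∈ e.source ∧ e.source ⊆ W ∧
      ContDiffOn ℝ r e.symm e.target := by
  have hr0 : (r : WithTop ℕ∞) ≠ 0 := by
    intro h
    have : r = 0 := by exact_mod_cast h
    simp [this] at hr
  have hfa : ContDiffAt ℝ r f a := hf.contDiffAt (hW.mem_nhds ha)
  let e₀ := hfa.toOpenPartialHomeomorph f hf' hr0
  have he₀ : (e₀ : E → F) = f := rfl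
  have hcont : ContinuousOn (fderiv ℝ f) W := hf.continuousOn_fderiv_of_isOpen hW (by exact_mod_cast hr)
  let S : Set E := W ∩ fderiv ℝ f ⁻¹' (range ((↑) : (E ≃L[ℝ] F) → E →L[ℝ] F))
  have hS : IsOpen S := hcont.isOpen_inter_preimage hW (ContinuousLinearEquiv.isOpen)
  refine ⟨e₀.restrOpen S hS, rfl, ⟨hfa.mem_toOpenPartialHomeomorph_source hf' hr0, ha, f', hf'.fderiv.symm⟩,
    fun x hx => hx.2.1, ?_⟩
  intro y hy
  have hx := (e₀.restrOpen S hS).map_target hy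
  obtain ⟨L, hL⟩ := hx.2.2
  refine ContDiffAt.contDiffWithinAt ((e₀.restrOpen S hS).contDiffAt_symm (f₀' := L) hy ?_ ?_)
  · rw [hL]
    exact ((hf.contDiffAt (hW.mem_nhds hx.2.1)).differentiableAt hr0).hasFDerivAt
  · exact hf.contDiffAt (hW.mem_nhds hx.2.1)

theorem flow_hle : (-1 : ℝ) ≤ 1 := by norm_num

/-- The continuous extension to the line of a curve on `[-1, 1]`. -/
noncomputable def flowExt {E : Type} [TopologicalSpace E] (α : C(Icc (-1 : ℝ) 1, E)) : ℝ → E :=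
  IccExtend flow_hle α

theorem flowExt_continuous {E : Type} [TopologicalSpace E] (α : C(Icc (-1 : ℝ) 1, E)) :
    Continuous (flowExt α) := α.continuous.Icc_extend'

theorem flowExt_of_mem {E : Type} [TopologicalSpace E] (α : C(Icc (-1 : ℝ) 1, E)) {t : ℝ}
    (ht : t ∈ Icc (-1 : ℝ) 1) : flowExt α t = α ⟨t, ht⟩ := IccExtend_of_mem _ _ ht

/-- Integration from `0` as a continuous linear map on curves. -/
noncomputable def flowJ (E : Type) [NormedAddCommGroup E] [NormedSpace ℝ E] [CompleteSpace E] :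
    C(Icc (-1 : ℝ) 1, E) →L[ℝ] C(Icc (-1 : ℝ) 1, E) :=
  LinearMap.mkContinuous
    { toFun := fun α => ⟨fun t => ∫ s in (0 : ℝ)..t, flowExt α s,
        (intervalIntegral.continuous_primitive
          (fun a b => (flowExt_continuous α).intervalIntegrable a b) 0).comp continuous_subtype_val⟩
      map_add' := by
        intro α β
        ext t
        simp only [ContinuousMap.coe_mk, ContinuousMap.add_apply]
        rw [← intervalIntegral.integral_add ((flowExt_continuous α).intervalIntegrable _ _)
          ((flowExt_continuous β).intervalIntegrable _ _)]
        rfl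
      map_smul' := by
        intro c α
        ext t
        simp only [ContinuousMap.coe_mk, ContinuousMap.smul_apply, RingHom.id_apply]
        rw [← intervalIntegral.integral_smul]
        rfl } 1
    (by
      intro α
      rw [ContinuousMap.norm_le _ (by positivity)]
      intro t
      have h := intervalIntegral.norm_integral_le_of_norm_le_const (a := 0) (b := (t : ℝ))
        (f := flowExt α) (C := ‖α‖) (fun s _ => α.norm_coe_le_norm _)
      have ht : |(t : ℝ) - 0| ≤ 1 := by
        rw [sub_zero, abs_le]; exact t.2
      calc _ ≤ ‖α‖ * |(t : ℝ) - 0| := h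
        _ ≤ ‖α‖ * 1 := mul_le_mul_of_nonneg_left ht (norm_nonneg α)
        _ = 1 * ‖α‖ := by ring)

theorem flowJ_apply {E : Type} [NormedAddCommGroup E] [NormedSpace ℝ E] [CompleteSpace E]
    (α : C(Icc (-1 : ℝ) 1, E)) (t : Icc (-1 : ℝ) 1) :
    flowJ E α t = ∫ s in (0 : ℝ)..t, flowExt α s := rfl

/-- Constant curves as a continuous linear map. -/
noncomputable def flowConst (E : Type) [NormedAddCommGroup E] [NormedSpace ℝ E] :
    E →L[ℝ] C(Icc (-1 : ℝ) 1, E) :=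
  LinearMap.mkContinuous
    { toFun := fun x => ContinuousMap.const _ x
      map_add' := by intros; rfl
      map_smul' := by intros; rfl } 1
    (by
      intro x
      rw [ContinuousMap.norm_le _ (by positivity)]
      intro t
      rw [one_mul]
      exact le_rfl)

theorem flowConst_apply {E : Type} [NormedAddCommGroup E] [NormedSpace ℝ E] (x : E)
    (t : Icc (-1 : ℝ) 1) : flowConst E x t = x := rfl

/-- Smooth solution operator for the rescaled integral equation. -/
theorem flow_solution {E : Type} [NormedAddCommGroup E] [NormedSpace ℝ E] [CompleteSpace E]
    (r : ℕ∞) (hr : 1 ≤ r) (v : C(E, E)) (hv : ContDiff ℝ r v) (x₀ : E) :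
    ∃ (δ ρ : ℝ) (S : E × ℝ → C(Icc (-1 : ℝ) 1, E)), 0 < δ ∧ 0 < ρ ∧
      ContDiffOn ℝ r S (Metric.ball (x₀, 0) δ) ∧
      (∀ q ∈ Metric.ball (x₀, (0 : ℝ)) δ, ‖S q - flowConst E x₀‖ < ρ ∧
        S q = flowConst E q.1 + q.2 • flowJ E (v.comp (S q))) ∧
      (∀ q ∈ Metric.ball (x₀, (0 : ℝ)) δ, ∀ β : C(Icc (-1 : ℝ) 1, E),
        ‖β - flowConst E x₀‖ < ρ → β = flowConst E q.1 + q.2 • flowJ E (v.comp β) → β = S q) := by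
  let X := C(Icc (-1 : ℝ) 1, E)
  let G : (E × ℝ) × X → (E × ℝ) × X := fun z =>
    (z.1, z.2 - flowConst E z.1.1 - z.1.2 • flowJ E (v.comp z.2))
  have hN : ContDiff ℝ r (fun β : X => v.comp β) := nem_contDiff r v hv
  have hG : ContDiff ℝ r G := by
    refine contDiff_fst.prodMk ((contDiff_snd.sub ?_).sub (ContDiff.fun_smul ?_ ?_))
    · exact (flowConst E).contDiff.comp (contDiff_fst.comp contDiff_fst)
    · exact contDiff_snd.comp contDiff_fst
    · exact (flowJ E).contDiff.comp (hN.comp contDiff_snd)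
  have hr0 : (r : WithTop ℕ∞) ≠ 0 := by
    intro h
    have : r = 0 := by exact_mod_cast h
    simp [this] at hr
  let a : (E × ℝ) × X := ((x₀, 0), flowConst E x₀)
  let D : (E × ℝ) →L[ℝ] X := -((flowConst E).comp (ContinuousLinearMap.fst ℝ E ℝ)) -
    (ContinuousLinearMap.snd ℝ E ℝ).smulRight (flowJ E (v.comp (flowConst E x₀)))
  let L : ((E × ℝ) × X) ≃L[ℝ] ((E × ℝ) × X) :=
    (ContinuousLinearEquiv.refl ℝ (E × ℝ)).skewProd (ContinuousLinearEquiv.refl ℝ X) D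
  have hL : HasFDerivAt G (L : ((E × ℝ) × X) →L[ℝ] ((E × ℝ) × X)) a := by
    have h1 : HasFDerivAt (fun z : (E × ℝ) × X => flowJ E (v.comp z.2))
        (fderiv ℝ (fun z : (E × ℝ) × X => flowJ E (v.comp z.2)) a) a :=
      (((flowJ E).contDiff.comp (hN.comp contDiff_snd)).differentiable hr0 a).hasFDerivAt
    have h2 : HasFDerivAt (fun z : (E × ℝ) × X => z.1.2)
        ((ContinuousLinearMap.snd ℝ E ℝ).comp (ContinuousLinearMap.fst ℝ (E × ℝ) X)) a :=
      ((ContinuousLinearMap.snd ℝ E ℝ).comp (ContinuousLinearMap.fst ℝ (E × ℝ) X)).hasFDerivAt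
    have h3 : HasFDerivAt (fun z : (E × ℝ) × X => flowConst E z.1.1)
        ((flowConst E).comp ((ContinuousLinearMap.fst ℝ E ℝ).comp
          (ContinuousLinearMap.fst ℝ (E × ℝ) X))) a :=
      ((flowConst E).comp ((ContinuousLinearMap.fst ℝ E ℝ).comp
          (ContinuousLinearMap.fst ℝ (E × ℝ) X))).hasFDerivAt
    have h4 := (hasFDerivAt_fst (𝕜 := ℝ) (p := a)).prodMk
      (((hasFDerivAt_snd (𝕜 := ℝ) (p := a)).sub h3).sub (h2.smul h1))
    refine h4.congr_fderiv ?_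
    refine ContinuousLinearMap.ext fun z => ?_
    refine Prod.ext rfl ?_
    simp [L, D, a]
    abel
  obtain ⟨e, he, ha, -, hsymm⟩ := invFun_contDiffOn r hr G univ isOpen_univ hG.contDiffOn a
    (mem_univ _) L hL
  have hGa : G a = ((x₀, 0), 0) := by simp [G, a]
  obtain ⟨ρ, hρ, hρs⟩ := Metric.isOpen_iff.1 e.open_source a ha
  have hta : ((x₀, (0 : ℝ)), (0 : X)) ∈ e.target := by
    rw [← hGa, ← he]; exact e.map_source ha
  have hsa : e.symm ((x₀, (0 : ℝ)), (0 : X)) = a := by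
    rw [← hGa, ← he]; exact e.left_inv ha
  have hcont : ContinuousAt (fun q : E × ℝ => e.symm (q, (0 : X))) (x₀, 0) :=
    ContinuousAt.comp (f := fun q : E × ℝ => (q, (0 : X))) (g := e.symm)
      (e.symm.continuousAt hta) (by fun_prop)
  have hev : ∀ᶠ q in 𝓝 (x₀, (0 : ℝ)), (q, (0 : X)) ∈ e.target ∧
      e.symm (q, (0 : X)) ∈ Metric.ball a ρ := by
    refine Filter.Eventually.and ?_ ?_
    · have : ContinuousAt (fun q : E × ℝ => (q, (0 : X))) (x₀, 0) := by fun_prop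
      exact this (e.open_target.mem_nhds hta)
    · apply hcont
      simp only [hsa]
      exact Metric.ball_mem_nhds a hρ
  obtain ⟨δ, hδ, hδs⟩ := Metric.eventually_nhds_iff_ball.1 hev
  have hfst : ∀ q ∈ Metric.ball (x₀, (0 : ℝ)) δ, G (e.symm (q, (0 : X))) = (q, 0) := by
    intro q hq
    rw [← he]
    exact e.right_inv (hδs q hq).1
  have hfst' : ∀ q ∈ Metric.ball (x₀, (0 : ℝ)) δ, (e.symm (q, (0 : X))).1 = q := by
    intro q hq
    exact congrArg Prod.fst (hfst q hq)
  refine ⟨δ, ρ, fun q => (e.symm (q, (0 : X))).2, hδ, hρ, ?_, ?_, ?_⟩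
  · refine contDiff_snd.comp_contDiffOn (hsymm.comp (f := fun q : E × ℝ => (q, (0 : X))) ?_ ?_)
    · exact (contDiff_id.prodMk contDiff_const).contDiffOn
    · exact fun q hq => (hδs q hq).1
  · intro q hq
    constructor
    · have h := (hδs q hq).2
      rw [Metric.mem_ball, Prod.dist_eq, max_lt_iff] at h
      rw [← dist_eq_norm]
      exact h.2
    · have h := congrArg Prod.snd (hfst q hq)
      simp only [G, hfst' q hq] at h
      rw [sub_sub, sub_eq_zero] at h
      exact h
  · intro q hq β hβ hβe
    have h := (hδs q hq).2
    rw [Metric.mem_ball, Prod.dist_eq, max_lt_iff, hfst' q hq] at h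
    have hs : (q, β) ∈ e.source := by
      apply hρs
      rw [Metric.mem_ball, Prod.dist_eq, max_lt_iff]
      refine ⟨h.1, ?_⟩
      rw [dist_eq_norm]
      exact hβ
    have h5 : e (q, β) = (q, 0) := by
      rw [he]
      refine Prod.ext rfl ?_
      simp only [G]
      rw [sub_sub, sub_eq_zero]
      exact hβe
    have h6 := e.left_inv hs
    rw [h5] at h6
    simp only [h6]

/-- Local flow of a `C^r` vector field, jointly `C^r` in time and initial value. -/
theorem exists_smooth_flow {E : Type} [NormedAddCommGroup E] [NormedSpace ℝ E] [CompleteSpace E]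
    (r : ℕ∞) (hr : 1 ≤ r) (v : E → E) (hv : ContDiff ℝ r v) (x₀ : E) :
    ∃ (δ : ℝ) (φ : E × ℝ → E), 0 < δ ∧ ContDiffOn ℝ r φ (Metric.ball (x₀, 0) δ) ∧
      (∀ x ∈ Metric.ball x₀ δ, φ (x, 0) = x) ∧
      (∀ x ∈ Metric.ball x₀ δ, ∀ t ∈ Ioo (-δ) δ,
        HasDerivAt (fun s => φ (x, s)) (v (φ (x, t))) t) := by
  obtain ⟨δ₀, ρ, S, hδ₀, hρ, hS, hSe, hSu⟩ := flow_solution r hr ⟨v, hv.continuous⟩ hv x₀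
  have hone : (1 : ℝ) ∈ Icc (-1 : ℝ) 1 := by norm_num
  have hball : ∀ x ∈ Metric.ball x₀ (δ₀ / 2), ∀ t ∈ Icc (-(δ₀ / 2)) (δ₀ / 2),
      (x, t) ∈ Metric.ball (x₀, (0 : ℝ)) δ₀ := by
    intro x hx t ht
    rw [Metric.mem_ball, Prod.dist_eq, max_lt_iff]
    rw [Metric.mem_ball] at hx
    refine ⟨by linarith, ?_⟩
    rw [Real.dist_eq, sub_zero, abs_lt]
    constructor <;> linarith [ht.1, ht.2]
  have hδ : 0 < δ₀ / 2 := by positivity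
  have hSe' : ∀ q ∈ Metric.ball (x₀, (0 : ℝ)) δ₀, ∀ u ∈ Icc (-1 : ℝ) 1,
      flowExt (S q) u = q.1 + q.2 • ∫ w in (0 : ℝ)..u, v (flowExt (S q) w) := by
    intro q hq u hu
    have h := DFunLike.congr_fun (hSe q hq).2 ⟨u, hu⟩
    rw [flowExt_of_mem _ hu, h]
    rfl
  have hscale : ∀ x ∈ Metric.ball x₀ (δ₀ / 2), ∀ t ∈ Icc (-(δ₀ / 2)) (δ₀ / 2),
      S (x, t) ⟨1, hone⟩ = flowExt (S (x, δ₀ / 2)) (t / (δ₀ / 2)) := by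
    intro x hx t ht
    have hδm : δ₀ / 2 ∈ Icc (-(δ₀ / 2)) (δ₀ / 2) := ⟨by linarith, le_rfl⟩
    set δ := δ₀ / 2 with hδdef
    set s := t / δ with hs
    set σ := S (x, δ) with hσ
    have hs1 : |s| ≤ 1 := by
      rw [hs, abs_div, abs_of_pos hδ, div_le_one hδ, abs_le]
      exact ht
    have hst : δ * s = t := by rw [hs]; field_simp
    have hmem : ∀ u ∈ Icc (-1 : ℝ) 1, s * u ∈ Icc (-1 : ℝ) 1 := by
      intro u hu
      rw [mem_Icc, ← abs_le] at hu ⊢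
      rw [abs_mul]
      exact mul_le_one₀ hs1 (abs_nonneg _) hu
    let β : C(Icc (-1 : ℝ) 1, E) := ⟨fun u => flowExt σ (s * u),
      (flowExt_continuous σ).comp (continuous_const.mul continuous_subtype_val)⟩
    have hβ : β = S (x, t) := by
      apply hSu _ (hball x hx t ht)
      · have h := (hSe _ (hball x hx δ hδm)).1
        rw [ContinuousMap.norm_lt_iff _ hρ]
        intro u
        have h1 := (ContinuousMap.norm_coe_le_norm (S (x, δ) - flowConst E x₀)
          ⟨s * u, hmem u u.2⟩).trans_lt h
        simp only [ContinuousMap.sub_apply, flowConst_apply, β, ContinuousMap.coe_mk] at h1 ⊢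
        rw [flowExt_of_mem _ (hmem u u.2)]
        exact h1
      · ext u
        have h1 : β u = flowExt σ (s * u) := rfl
        rw [h1, hSe' _ (hball x hx δ hδm) _ (hmem u u.2)]
        simp only [ContinuousMap.add_apply, ContinuousMap.smul_apply, flowConst_apply, flowJ_apply]
        congr 1
        rw [← hst, mul_smul]
        congr 1
        have h2 := intervalIntegral.smul_integral_comp_mul_left
          (fun w => v (flowExt (S (x, δ)) w)) s (a := 0) (b := (u : ℝ))
        rw [mul_zero] at h2
        rw [← h2]
        congr 1
        apply intervalIntegral.integral_congr
        intro w hw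
        have hw1 : w ∈ Icc (-1 : ℝ) 1 := by
          have h0 : (0 : ℝ) ∈ Icc (-1 : ℝ) 1 := by norm_num
          exact (uIcc_subset_Icc h0 u.2) hw
        simp only
        rw [flowExt_of_mem _ hw1]
        rfl
    rw [← hβ]
    change flowExt σ (s * 1) = _
    rw [mul_one]
  refine ⟨δ₀ / 2, fun q => S q ⟨1, hone⟩, hδ, ?_, ?_, ?_⟩
  · have h1 : ContDiffOn ℝ r S (Metric.ball (x₀, 0) (δ₀ / 2)) :=
      hS.mono (Metric.ball_subset_ball (by linarith))
    exact (ContinuousMap.evalCLM ℝ (⟨1, hone⟩ : Icc (-1 : ℝ) 1)).contDiff.comp_contDiffOn h1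
  · intro x hx
    have h := DFunLike.congr_fun (hSe (x, 0) (hball x hx 0 ⟨by linarith, hδ.le⟩)).2 ⟨1, hone⟩
    simp only [zero_smul, add_zero] at h
    simpa [flowConst_apply] using h
  · intro x hx t ht
    have hδm : δ₀ / 2 ∈ Icc (-(δ₀ / 2)) (δ₀ / 2) := ⟨by linarith, le_rfl⟩
    have hev : (fun s => S (x, s) ⟨1, hone⟩) =ᶠ[𝓝 t] fun s => x + (δ₀ / 2) •
        ∫ w in (0 : ℝ)..(s / (δ₀ / 2)), v (flowExt (S (x, δ₀ / 2)) w) := by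
      filter_upwards [isOpen_Ioo.mem_nhds ht] with s hs
      rw [hscale x hx s (Ioo_subset_Icc_self hs), hSe' _ (hball x hx _ hδm)]
      rw [mem_Icc, ← abs_le, abs_div, abs_of_pos hδ, div_le_one hδ, abs_le]
      exact Ioo_subset_Icc_self hs
    refine HasDerivAt.congr_of_eventuallyEq ?_ hev
    simp only
    rw [hscale x hx t (Ioo_subset_Icc_self ht)]
    have hc : Continuous fun w => v (flowExt (S (x, δ₀ / 2)) w) :=
      hv.continuous.comp (flowExt_continuous _)
    have h1 := (hc.integral_hasStrictDerivAt 0 (t / (δ₀ / 2))).hasDerivAt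
    have h2 : HasDerivAt (fun s : ℝ => s / (δ₀ / 2)) (1 / (δ₀ / 2)) t :=
      (hasDerivAt_id t).div_const _
    have h3 := ((HasDerivAt.scomp t h1 h2).const_smul (δ₀ / 2)).const_add x
    convert! h3 using 1
    rw [smul_smul, mul_one_div_cancel hδ.ne', one_smul]

/-- The geodesic spray on `TU = U × ℝⁿ`. -/
noncomputable def geoSpray (n : ℕ) (Γ : Fin n → Fin n → Fin n → (Fin n → ℝ) → ℝ)
    (z : (Fin n → ℝ) × (Fin n → ℝ)) : (Fin n → ℝ) × (Fin n → ℝ) :=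
  (z.2, fun h => -∑ i, ∑ j, Γ h i j z.1 * z.2 i * z.2 j)

theorem geoSpray_contDiff (n : ℕ) (r : ℕ∞) (Γ : Fin n → Fin n → Fin n → (Fin n → ℝ) → ℝ)
    (hΓ : ∀ h i j, ContDiff ℝ r (Γ h i j)) : ContDiff ℝ r (geoSpray n Γ) := by
  refine contDiff_snd.prodMk (contDiff_pi.2 fun h => ContDiff.neg ?_)
  refine ContDiff.sum fun i _ => ContDiff.sum fun j _ => ?_
  have h1 : ContDiff ℝ r (fun z : (Fin n → ℝ) × (Fin n → ℝ) => Γ h i j z.1) :=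
    (hΓ h i j).comp contDiff_fst
  fun_prop

/-- Initial data on the hypersurface transversal to the first coordinate direction. -/
noncomputable def geoInit (n : ℕ) (i₀ : Fin n) (p y : Fin n → ℝ) : (Fin n → ℝ) × (Fin n → ℝ) :=
  (p + (y - y i₀ • Pi.single i₀ 1), Pi.single i₀ 1)

theorem geoInit_contDiff (n : ℕ) (i₀ : Fin n) (p : Fin n → ℝ) (r : ℕ∞) :
    ContDiff ℝ r (geoInit n i₀ p) := by
  unfold geoInit
  fun_prop

theorem geoInit_coordLine (n : ℕ) (i₀ : Fin n) (hi : (i₀ : ℕ) = 0) (p a : Fin n → ℝ) (s t : ℝ) :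
    geoInit n i₀ p (coordLine n a s) = geoInit n i₀ p (coordLine n a t) := by
  unfold geoInit coordLine
  refine Prod.ext ?_ rfl
  ext k
  by_cases hk : k = i₀
  · subst hk
    simp [hi]
  · have : (k : ℕ) ≠ 0 := fun h => hk (Fin.ext (h.trans hi.symm))
    simp [hi, hk, this]

theorem geo_cutoff (n : ℕ) (r : ℕ∞) (U : Set (Fin n → ℝ)) (hU : IsOpen U) (p : Fin n → ℝ)
    (hp : p ∈ U) (Γ : Fin n → Fin n → Fin n → (Fin n → ℝ) → ℝ)
    (hΓ : ∀ h i j, ContDiffOn ℝ r (Γ h i j) U) :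
    ∃ (R : ℝ) (Γ' : Fin n → Fin n → Fin n → (Fin n → ℝ) → ℝ), 0 < R ∧ Metric.ball p R ⊆ U ∧
      (∀ h i j, ContDiff ℝ r (Γ' h i j)) ∧
      ∀ h i j, ∀ x ∈ Metric.ball p R, Γ' h i j x = Γ h i j x := by
  obtain ⟨R, hR, hRU⟩ := Metric.isOpen_iff.1 hU p hp
  let χ : ContDiffBump p := ⟨R / 3, R / 2, by positivity, by linarith⟩
  refine ⟨R / 3, fun h i j x => χ x * Γ h i j x, by positivity,
    (Metric.ball_subset_ball (by linarith)).trans hRU, ?_, ?_⟩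
  · intro h i j
    refine contDiff_iff_contDiffAt.2 fun x => ?_
    by_cases hx1 : x ∈ tsupport χ
    swap
    · have h0 : (fun x => χ x * Γ h i j x) =ᶠ[𝓝 x] fun _ => 0 := by
        filter_upwards [notMem_tsupport_iff_eventuallyEq.1 hx1] with y hy
        rw [hy]; simp
      exact contDiffAt_const.congr_of_eventuallyEq h0
    rw [χ.tsupport_eq] at hx1
    have hxU : x ∈ U := hRU (Metric.closedBall_subset_ball (by simp only [χ]; linarith) hx1)
    exact χ.contDiffAt.mul ((hΓ h i j).contDiffAt (hU.mem_nhds hxU))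
  · intro h i j x hx
    have : χ x = 1 := χ.one_of_mem_closedBall (Metric.ball_subset_closedBall hx)
    simp [this]

theorem exists_pre_semigeodesic_coordinates_geodesic_lines
    (n : ℕ) (hn : 2 ≤ n) (r : ℕ∞) (hr : 2 ≤ r)
    (U : Set (Fin n → ℝ)) (hU : IsOpen U) (p : Fin n → ℝ) (hp : p ∈ U)
    (Γ : Fin n → Fin n → Fin n → (Fin n → ℝ) → ℝ)
    (hΓ : ∀ h i j, ContDiffOn ℝ r (Γ h i j) U) :
    ∃ (U' V : Set (Fin n → ℝ)) (f g : (Fin n → ℝ) → (Fin n → ℝ)),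
      IsOpen U' ∧ p ∈ U' ∧ U' ⊆ U ∧ IsOpen V ∧
      Set.BijOn f U' V ∧ (∀ x ∈ U', g (f x) = x) ∧ (∀ y ∈ V, f (g y) = y) ∧
      ContDiffOn ℝ r f U' ∧ ContDiffOn ℝ r g V ∧
      ∀ (a : Fin n → ℝ) (I : Set ℝ), IsOpen I → I.OrdConnected →
        (∀ τ ∈ I, coordLine n a τ ∈ V) →
        ∀ τ ∈ I, IsGeodesicAt n Γ (fun s => g (coordLine n a s)) τ := by
  have hr1 : 1 ≤ r := le_trans (by norm_num) hr
  have hr0 : (r : WithTop ℕ∞) ≠ 0 := by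
    intro h
    have : r = 0 := by exact_mod_cast h
    simp [this] at hr1
  obtain ⟨R, Γ', hR, hRU, hΓ', hΓΓ⟩ := geo_cutoff n r U hU p hp Γ hΓ
  let i₀ : Fin n := ⟨0, by omega⟩
  let e₀ : Fin n → ℝ := Pi.single i₀ 1
  obtain ⟨δ, φ, hδ, hφ, hφ0, hφd⟩ := exists_smooth_flow r hr1 (geoSpray n Γ')
    (geoSpray_contDiff n r Γ' hΓ') (p, e₀)
  let g : (Fin n → ℝ) → (Fin n → ℝ) := fun y => (φ (geoInit n i₀ p y, y i₀)).1
  let q : (Fin n → ℝ) → ((Fin n → ℝ) × (Fin n → ℝ)) × ℝ := fun y => (geoInit n i₀ p y, y i₀)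
  have hq : ContDiff ℝ r q := (geoInit_contDiff n i₀ p r).prodMk (contDiff_apply ℝ ℝ i₀)
  let W : Set (Fin n → ℝ) := q ⁻¹' Metric.ball ((p, e₀), 0) δ
  have hW : IsOpen W := Metric.isOpen_ball.preimage hq.continuous
  have hinit0 : geoInit n i₀ p 0 = (p, e₀) := by simp [geoInit, e₀]
  have hq0 : q 0 = ((p, e₀), 0) := by simp [q, hinit0]
  have hW0 : (0 : Fin n → ℝ) ∈ W := by
    simp only [W, mem_preimage, hq0]
    exact Metric.mem_ball_self hδ
  have hWmem : ∀ y ∈ W, geoInit n i₀ p y ∈ Metric.ball (p, e₀) δ ∧ y i₀ ∈ Ioo (-δ) δ := by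
    intro y hy
    have hy' : dist (q y) ((p, e₀), 0) < δ := hy
    rw [Prod.dist_eq, max_lt_iff] at hy'
    refine ⟨hy'.1, ?_⟩
    have := hy'.2
    rw [Real.dist_eq, sub_zero, abs_lt] at this
    exact this
  have hg : ContDiffOn ℝ r g W :=
    contDiff_fst.comp_contDiffOn (hφ.comp hq.contDiffOn (fun y hy => hy))
  have hp0 : (p, e₀) ∈ Metric.ball (p, e₀) δ := Metric.mem_ball_self hδ
  have hg0 : g 0 = p := by
    simp only [g, hinit0, Pi.zero_apply]
    rw [hφ0 _ hp0]
  let W' := W ∩ g ⁻¹' Metric.ball p R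
  have hW' : IsOpen W' := hg.continuousOn.isOpen_inter_preimage hW Metric.isOpen_ball
  have hW'0 : (0 : Fin n → ℝ) ∈ W' := ⟨hW0, by
    rw [mem_preimage, hg0]; exact Metric.mem_ball_self hR⟩
  -- the derivative at the origin is the identity
  have hgd : HasFDerivAt g
      ((ContinuousLinearEquiv.refl ℝ (Fin n → ℝ) : (Fin n → ℝ) ≃L[ℝ] (Fin n → ℝ)) :
        (Fin n → ℝ) →L[ℝ] (Fin n → ℝ)) 0 := by
    have h0 : HasFDerivAt g (fderiv ℝ g 0) 0 :=
      ((hg.contDiffAt (hW.mem_nhds hW0)).differentiableAt hr0).hasFDerivAt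
    have hline : ∀ w : Fin n → ℝ, HasDerivAt (fun s : ℝ => g (s • w)) (fderiv ℝ g 0 w) 0 := by
      intro w
      have h1 : HasDerivAt (fun s : ℝ => s • w) w 0 := by
        simpa using (hasDerivAt_id (0 : ℝ)).smul_const w
      have h2 : HasFDerivAt g (fderiv ℝ g 0) ((0 : ℝ) • w) := by rwa [zero_smul]
      exact h2.comp_hasDerivAt (0 : ℝ) h1
    have hlineW : ∀ w : Fin n → ℝ, ∀ᶠ s : ℝ in 𝓝 0, s • w ∈ W := by
      intro w
      have hc : ContinuousAt (fun s : ℝ => s • w) 0 := by fun_prop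
      refine hc (hW.mem_nhds ?_)
      simpa using hW0
    have he : fderiv ℝ g 0 e₀ = e₀ := by
      refine (hline e₀).unique ?_
      have h1 := (hφd (p, e₀) hp0 0 ⟨by linarith, hδ⟩).fst
      rw [hφ0 _ hp0] at h1
      refine HasDerivAt.congr_of_eventuallyEq h1 (Filter.Eventually.of_forall fun s => ?_)
      have h2 : geoInit n i₀ p (s • e₀) = (p, e₀) := by simp [geoInit, e₀]
      have h3 : (s • e₀) i₀ = s := by simp [e₀]
      simp only [g, h2, h3]
    have hw : ∀ w : Fin n → ℝ, w i₀ = 0 → fderiv ℝ g 0 w = w := by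
      intro w hw
      refine (hline w).unique ?_
      have h1 : HasDerivAt (fun s : ℝ => p + s • w) w 0 := by
        simpa using ((hasDerivAt_id (0 : ℝ)).smul_const w).const_add p
      refine HasDerivAt.congr_of_eventuallyEq h1 ?_
      filter_upwards [hlineW w] with s hs
      have h3 : (s • w) i₀ = 0 := by simp [hw]
      simp only [g, h3]
      rw [hφ0 _ (hWmem _ hs).1]
      simp [geoInit, hw]
    refine h0.congr_fderiv (ContinuousLinearMap.ext fun w => ?_)
    have h4 : w = (w - w i₀ • e₀) + w i₀ • e₀ := by abel
    have h5 := hw (w - w i₀ • e₀) (by simp [e₀])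
    calc fderiv ℝ g 0 w = fderiv ℝ g 0 (w - w i₀ • e₀) + w i₀ • fderiv ℝ g 0 e₀ := by
          rw [← map_smul, ← map_add, ← h4]
      _ = w := by rw [h5, he, ← h4]
  obtain ⟨e, heg, he0, heW, hes⟩ := invFun_contDiffOn r hr1 g W' hW' (hg.mono inter_subset_left)
    0 hW'0 _ hgd
  have hmaps : ∀ x ∈ e.target, x ∈ Metric.ball p R := by
    intro x hx
    have h1 := (heW (e.map_target hx)).2
    rw [mem_preimage, ← heg, e.right_inv hx] at h1
    exact h1
  refine ⟨e.target, e.source, e.symm, g, e.open_target, ?_, fun x hx => hRU (hmaps x hx),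
    e.open_source, e.symm.bijOn, ?_, ?_, hes, hg.mono (heW.trans inter_subset_left), ?_⟩
  · rw [← hg0, ← heg]; exact e.map_source he0
  · intro x hx
    rw [← heg]; exact e.right_inv hx
  · intro y hy
    rw [← heg]; exact e.left_inv hy
  · intro a I hI _ hIV τ hτ
    let ζ := geoInit n i₀ p (coordLine n a τ)
    have hline0 : ∀ s, coordLine n a s i₀ = s := fun s => by simp [coordLine, i₀]
    have hc : ∀ s, g (coordLine n a s) = (φ (ζ, s)).1 := by
      intro s
      simp only [g, hline0]
      rw [geoInit_coordLine n i₀ rfl p a s τ]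
    have hζ : ζ ∈ Metric.ball (p, e₀) δ := (hWmem _ (heW (hIV τ hτ)).1).1
    have hd : ∀ s ∈ I, HasDerivAt (fun u => φ (ζ, u)) (geoSpray n Γ' (φ (ζ, s))) s := by
      intro s hs
      have h1 := (hWmem _ (heW (hIV s hs)).1).2
      rw [hline0] at h1
      exact hφd ζ hζ s h1
    have hd1 : ∀ s ∈ I, ∀ k, deriv (fun u => (φ (ζ, u)).1 k) s = (φ (ζ, s)).2 k := by
      intro s hs k
      exact (hasDerivAt_pi.1 (hd s hs).fst k).deriv
    have hd2 : ∀ k, deriv (fun s => deriv (fun u => (φ (ζ, u)).1 k) s) τ =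
        (geoSpray n Γ' (φ (ζ, τ))).2 k := by
      intro k
      have h1 : (fun s => deriv (fun u => (φ (ζ, u)).1 k) s) =ᶠ[𝓝 τ]
          fun s => (φ (ζ, s)).2 k := by
        filter_upwards [hI.mem_nhds hτ] with s hs
        exact hd1 s hs k
      rw [h1.deriv_eq]
      exact (hasDerivAt_pi.1 (hd τ hτ).snd k).deriv
    intro h
    simp only [hc]
    rw [hd2]
    have hball : (φ (ζ, τ)).1 ∈ Metric.ball p R := by
      rw [← hc]
      exact (heW (hIV τ hτ)).2
    simp only [hd1 τ hτ, geoSpray, hΓΓ _ _ _ _ hball]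
    exact neg_add_cancel _
end

section
/- Let n ≥ 1, let r ∈ ℕ ∪ {∞} with r ≥ 1, let W ⊆ ℝⁿ be open, p ∈ W, and let ξ : W → ℝⁿ be a vector field of class Cʳ with ξ(p) ≠ 0. Then there exist an open set V with p ∈ V ⊆ W and a map f : V → ℝⁿ of class Cʳ which is injective with invertible differential at every point of V (so f is a Cʳ coordinate transformation onto the open set f(V)), such that for every x ∈ V the pushforward of ξ is the first standard basis vector: (Df(x))(ξ(x)) = e₁, i.e. Σ_α ξ^α(x) ∂f^h/∂x^α(x) = δ^h₁ for all h ∈ {1,…,n}. -/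
open Set

open scoped Topology unitInterval

theorem st_local_diffeo {E F : Type*} [NormedAddCommGroup E] [NormedSpace ℝ E] [CompleteSpace E]
    [NormedAddCommGroup F] [NormedSpace ℝ F] (r : ℕ∞) (hr : 1 ≤ r) (G : E → F) (a : E)
    (U : Set E) (hU : U ∈ 𝓝 a) (hG : ∀ y ∈ U, ContDiffAt ℝ r G y) (e : E ≃L[ℝ] F)
    (he : HasFDerivAt G (e : E →L[ℝ] F) a) :
    ∃ h : OpenPartialHomeomorph E F, (h : E → F) = G ∧ a ∈ h.source ∧ h.source ⊆ U ∧
      (∀ y ∈ h.source, ∃ e' : E ≃L[ℝ] F, HasFDerivAt G (e' : E →L[ℝ] F) y) ∧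
      (∀ z ∈ h.target, ContDiffAt ℝ r h.symm z) := by
  have hr0 : (r : WithTop ℕ∞) ≠ 0 := by
    have : r ≠ 0 := by rintro rfl; simp at hr
    exact_mod_cast this
  have hr1 : (1 : WithTop ℕ∞) ≤ r := by exact_mod_cast hr
  have ha := hG a (mem_of_mem_nhds hU)
  have hc : ContinuousAt (fderiv ℝ G) a :=
    (ha.fderiv_right (m := 0) (by simpa using hr1)).continuousAt
  have h1 : ∀ᶠ y in 𝓝 a, fderiv ℝ G y ∈ range ((↑) : (E ≃L[ℝ] F) → E →L[ℝ] F) := by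
    apply hc
    rw [he.fderiv]
    exact ContinuousLinearEquiv.nhds e
  obtain ⟨U', hU', hU'o, haU'⟩ := mem_nhds_iff.1 (Filter.inter_mem hU h1)
  let h := (ha.toOpenPartialHomeomorph G he hr0).restrOpen U' hU'o
  have hcoe : (h : E → F) = G := rfl
  have hs : h.source ⊆ U' := by
    intro y hy
    exact hy.2
  have key : ∀ y ∈ h.source, ∃ e' : E ≃L[ℝ] F, HasFDerivAt G (e' : E →L[ℝ] F) y := by
    intro y hy
    obtain ⟨hyU, e', he'⟩ := hU' (hs hy)
    refine ⟨e', ?_⟩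
    rw [he']
    exact ((hG y hyU).differentiableAt hr0).hasFDerivAt
  refine ⟨h, hcoe, ⟨ha.mem_toOpenPartialHomeomorph_source he hr0, haU'⟩,
    fun y hy => (hU' (hs hy)).1, key, ?_⟩
  intro z hz
  have hz' := h.map_target hz
  obtain ⟨e', he'⟩ := key _ hz'
  exact h.contDiffAt_symm hz he' (hG _ (hU' (hs hz')).1)

noncomputable def stApply (E F : Type) [NormedAddCommGroup E] [NormedSpace ℝ E]
    [NormedAddCommGroup F] [NormedSpace ℝ F] :
    C(I, E →L[ℝ] F) →L[ℝ] C(I, E) →L[ℝ] C(I, F) :=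
  LinearMap.mkContinuous₂
    (LinearMap.mk₂ ℝ (fun (A : C(I, E →L[ℝ] F)) (u : C(I, E)) => (⟨fun t => A t (u t), by fun_prop⟩ : C(I, F)))
      (by intros; ext; simp) (by intros; ext; simp) (by intros; ext; simp)
      (by intros; ext; simp)) 1 (by
      intro A u
      rw [ContinuousMap.norm_le _ (by positivity)]
      intro t
      simp only [LinearMap.mk₂_apply, ContinuousMap.coe_mk, one_mul]
      refine ((A t).le_opNorm _).trans ?_
      gcongr
      · exact A.norm_coe_le_norm t
      · exact u.norm_coe_le_norm t)

theorem stApply_apply {E F : Type} [NormedAddCommGroup E] [NormedSpace ℝ E]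
    [NormedAddCommGroup F] [NormedSpace ℝ F] (A : C(I, E →L[ℝ] F)) (u : C(I, E)) (t : I) :
    stApply E F A u t = A t (u t) := rfl

theorem st_nemytskii_hasFDerivAt {E F : Type} [NormedAddCommGroup E] [NormedSpace ℝ E]
    [NormedAddCommGroup F] [NormedSpace ℝ F] (g : C(E, F)) (g' : C(E, E →L[ℝ] F))
    (hg : ∀ x, HasFDerivAt g (g' x) x) (u : C(I, E)) :
    HasFDerivAt (fun v : C(I, E) => g.comp v) (stApply E F (g'.comp u)) u := by
  rw [hasFDerivAt_iff_isLittleO, Asymptotics.isLittleO_iff]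
  intro c hc
  have hK : IsCompact (range u) := isCompact_range u.continuous
  have := hK.uniformContinuousAt_of_continuousAt g' (fun a _ => g'.continuous.continuousAt)
    (Metric.dist_mem_uniformity hc)
  obtain ⟨δ, hδ, hδ'⟩ := Metric.mem_uniformity_dist.1 this
  filter_upwards [Metric.ball_mem_nhds u hδ] with v hv
  rw [ContinuousMap.norm_le _ (by positivity)]
  intro t
  have hvt : v t ∈ Metric.ball (u t) δ :=
    lt_of_le_of_lt (ContinuousMap.dist_apply_le_dist t) hv
  have h2 := Convex.norm_image_sub_le_of_norm_hasFDerivWithin_le' (𝕜 := ℝ) (f := g) (f' := g')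
    (s := Metric.ball (u t) δ) (φ := g' (u t)) (C := c) (x := u t) (y := v t)
    (fun x _ => (hg x).hasFDerivWithinAt)
    (by
      intro x hx
      rw [← dist_eq_norm, dist_comm]
      exact (hδ' (a := u t) (b := x) (by rw [dist_comm]; exact hx) (mem_range_self t)).le)
    (convex_ball _ _) (Metric.mem_ball_self hδ) hvt
  refine h2.trans ?_
  gcongr
  exact (v - u).norm_coe_le_norm t

theorem st_nemytskii_nat (E : Type) [NormedAddCommGroup E] [NormedSpace ℝ E] (k : ℕ) :
    ∀ (F : Type) [NormedAddCommGroup F] [NormedSpace ℝ F] (g : C(E, F)),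
      ContDiff ℝ k g → ContDiff ℝ k (fun v : C(I, E) => g.comp v) := by
  induction k with
  | zero =>
    intro F _ _ g hg
    rw [Nat.cast_zero, contDiff_zero]
    exact g.continuous_postcomp
  | succ k ih =>
    intro F _ _ g hg
    have hg' : ContDiff ℝ k (fderiv ℝ g) := hg.fderiv_right (by push_cast; rfl)
    let g' : C(E, E →L[ℝ] F) := ⟨fderiv ℝ g, hg'.continuous⟩
    have h := st_nemytskii_hasFDerivAt g g'
      (fun x => (hg.differentiable (by simp) x).hasFDerivAt)
    rw [Nat.cast_succ, contDiff_succ_iff_fderiv]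
    refine ⟨fun u => (h u).differentiableAt, by simp, ?_⟩
    have : fderiv ℝ (fun v : C(I, E) => g.comp v) = fun u => stApply E F (g'.comp u) :=
      funext fun u => (h u).fderiv
    rw [this]
    exact (ContinuousLinearMap.contDiff (F := C(I, E) →L[ℝ] C(I, F)) (stApply E F)).comp (ih _ g' hg')

theorem st_nemytskii (E : Type) [NormedAddCommGroup E] [NormedSpace ℝ E] (r : ℕ∞)
    (F : Type) [NormedAddCommGroup F] [NormedSpace ℝ F] (g : C(E, F))
    (hg : ContDiff ℝ r g) : ContDiff ℝ r (fun v : C(I, E) => g.comp v) := by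
  induction r using ENat.recTopCoe with
  | top =>
    exact contDiff_infty.2 fun k => st_nemytskii_nat E k F g (contDiff_infty.1 hg k)
  | coe k => exact st_nemytskii_nat E k F g hg

noncomputable def stInt (E : Type) [NormedAddCommGroup E] [NormedSpace ℝ E] :
    C(I, E) →L[ℝ] C(I, E) :=
  LinearMap.mkContinuous
    { toFun := fun u => ⟨fun t => ∫ τ in (0:ℝ)..t, u (projIcc 0 1 zero_le_one τ), by
        have : Continuous fun x : ℝ => ∫ τ in (0:ℝ)..x, u (projIcc 0 1 zero_le_one τ) :=
          intervalIntegral.continuous_primitive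
            (fun a b => Continuous.intervalIntegrable (by fun_prop) _ _) 0
        exact this.comp continuous_subtype_val⟩
      map_add' := by
        intro u v
        ext t
        simp only [ContinuousMap.coe_mk, ContinuousMap.add_apply]
        exact intervalIntegral.integral_add (Continuous.intervalIntegrable (by fun_prop) _ _)
          (Continuous.intervalIntegrable (by fun_prop) _ _)
      map_smul' := by
        intro c u
        ext t
        simp } 1 (by
      intro u
      rw [ContinuousMap.norm_le _ (by positivity)]
      intro t
      simp only [LinearMap.coe_mk, AddHom.coe_mk, ContinuousMap.coe_mk, one_mul]
      refine (intervalIntegral.norm_integral_le_of_norm_le_const (C := ‖u‖)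
        (fun τ _ => u.norm_coe_le_norm _)).trans ?_
      have h0 := t.2.1
      have h1 := t.2.2
      rw [sub_zero, abs_of_nonneg h0]
      exact mul_le_of_le_one_right (norm_nonneg _) h1)

theorem stInt_apply {E : Type} [NormedAddCommGroup E] [NormedSpace ℝ E] (u : C(I, E)) (t : I) :
    stInt E u t = ∫ τ in (0:ℝ)..t, u (projIcc 0 1 zero_le_one τ) := rfl

theorem stInt_norm_le {E : Type} [NormedAddCommGroup E] [NormedSpace ℝ E] (u : C(I, E)) :
    ‖stInt E u‖ ≤ ‖u‖ := by
  have h : ‖stInt E‖ ≤ 1 := LinearMap.mkContinuous_norm_le _ zero_le_one _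
  simpa using (stInt E).le_of_opNorm_le h u

theorem st_flow (E : Type) [NormedAddCommGroup E] [NormedSpace ℝ E] [CompleteSpace E]
    (r : ℕ∞) (hr : 1 ≤ r) (g : C(E, E)) (hg : ContDiff ℝ r g) (K : NNReal)
    (hK : LipschitzWith K g) (p : E) :
    ∃ Φ : ℝ → E → E, ∃ N ∈ 𝓝 ((0 : ℝ), p), ∀ q ∈ N, Φ 0 q.2 = q.2 ∧
      HasDerivAt (fun s => Φ s q.2) (g (Φ q.1 q.2)) q.1 ∧
      ContDiffAt ℝ r (fun q : ℝ × E => Φ q.1 q.2) q := by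
  have hr1 : (1 : WithTop ℕ∞) ≤ r := by exact_mod_cast hr
  obtain ⟨δ, hδ, ε, hε, H⟩ :=
    (hg.contDiffAt.of_le hr1 :
      ContDiffAt ℝ 1 g p).exists_forall_mem_closedBall_exists_eq_forall_mem_Ioo_hasDerivAt 0
  have H' : ∀ x, ∃ α : ℝ → E, x ∈ Metric.closedBall p δ → α 0 = x ∧
      ∀ t ∈ Ioo (0 - ε) (0 + ε), HasDerivAt α (g (α t)) t := by
    intro x
    by_cases hx : x ∈ Metric.closedBall p δ
    · obtain ⟨α, hα⟩ := H x hx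
      exact ⟨α, fun _ => hα⟩
    · exact ⟨0, fun h => absurd h hx⟩
  choose α hα using H'
  let G : ℝ × C(I, E) → ℝ × C(I, E) :=
    fun q => (q.1, q.2 - q.1 • stInt E (g.comp q.2))
  have hN : ContDiff ℝ r (fun v : C(I, E) => stInt E (g.comp v)) :=
    (ContinuousLinearMap.contDiff (F := C(I, E)) (stInt E)).comp (st_nemytskii E r E g hg)
  have hGc : ContDiff ℝ r G :=
    contDiff_fst.prodMk (contDiff_snd.sub (contDiff_fst.smul (hN.comp contDiff_snd)))
  let u0 : C(I, E) := ContinuousMap.const I p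
  let c0 : C(I, E) := stInt E (g.comp u0)
  let e : (ℝ × C(I, E)) ≃L[ℝ] (ℝ × C(I, E)) :=
    (ContinuousLinearEquiv.refl ℝ ℝ).skewProd (ContinuousLinearEquiv.refl ℝ C(I, E))
      (-(ContinuousLinearMap.toSpanSingleton ℝ c0))
  have he : HasFDerivAt G (e : (ℝ × C(I, E)) →L[ℝ] (ℝ × C(I, E))) ((0 : ℝ), u0) := by
    have hr0 : (r : WithTop ℕ∞) ≠ 0 := fun h => by rw [h] at hr1; simp at hr1
    have hd : HasFDerivAt (fun q : ℝ × C(I, E) => stInt E (g.comp q.2))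
        (fderiv ℝ (fun q : ℝ × C(I, E) => stInt E (g.comp q.2)) ((0 : ℝ), u0)) ((0 : ℝ), u0) :=
      ((hN.comp contDiff_snd).differentiable hr0 _).hasFDerivAt
    have h1 : HasFDerivAt G _ ((0 : ℝ), u0) := HasFDerivAt.prodMk
      (hasFDerivAt_fst (𝕜 := ℝ) (p := ((0 : ℝ), u0)))
      ((hasFDerivAt_snd (𝕜 := ℝ) (p := ((0 : ℝ), u0))).sub
        ((hasFDerivAt_fst (𝕜 := ℝ) (p := ((0 : ℝ), u0))).smul hd))
    refine h1.congr_fderiv ?_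
    apply ContinuousLinearMap.ext
    rintro ⟨c, w⟩
    simp [e, c0, sub_eq_add_neg]
  obtain ⟨h, hcoe, ha, -, -, hsymm⟩ :=
    st_local_diffeo r hr G ((0 : ℝ), u0) univ Filter.univ_mem (fun y _ => hGc.contDiffAt) e he
  have hinj : ∀ (s : ℝ) (u v : C(I, E)), |s| * K < 1 → G (s, u) = G (s, v) → u = v := by
    intro s u v hs huv
    have h2 : u - s • stInt E (g.comp u) = v - s • stInt E (g.comp v) := congrArg Prod.snd huv
    have h3 : u - v = s • stInt E (g.comp u - g.comp v) := by
      rw [map_sub, smul_sub, sub_eq_sub_iff_add_eq_add]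
      have := sub_eq_sub_iff_add_eq_add.1 h2
      rw [this, add_comm]
    have h4 : ‖g.comp u - g.comp v‖ ≤ K * ‖u - v‖ := by
      rw [ContinuousMap.norm_le _ (by positivity)]
      intro t
      refine (hK.norm_sub_le (u t) (v t)).trans ?_
      gcongr
      exact (u - v).norm_coe_le_norm t
    have h5 : ‖u - v‖ ≤ |s| * K * ‖u - v‖ := by
      calc ‖u - v‖ = |s| * ‖stInt E (g.comp u - g.comp v)‖ := by
            conv_lhs => rw [h3]
            rw [norm_smul, Real.norm_eq_abs]
        _ ≤ |s| * (K * ‖u - v‖) := by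
            gcongr
            exact (stInt_norm_le _).trans h4
        _ = _ := by ring
    have h6 : ‖u - v‖ = 0 := by nlinarith [norm_nonneg (u - v)]
    exact sub_eq_zero.1 (norm_eq_zero.1 h6)
  let κ : ℝ × E → ℝ × C(I, E) := fun q => (q.1, ContinuousLinearMap.const ℝ I q.2)
  have hκ : ContDiff ℝ r κ := contDiff_fst.prodMk
    ((ContinuousLinearMap.contDiff (F := C(I, E)) (ContinuousLinearMap.const ℝ I)).comp
      contDiff_snd)
  let O : Set (ℝ × E) := {q | |q.1| < ε ∧ |q.1| * K < 1 ∧ dist q.2 p < δ ∧ κ q ∈ h.target}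
  have hO : IsOpen O := by
    have o1 : IsOpen {q : ℝ × E | |q.1| < ε} := isOpen_lt (by fun_prop) (by fun_prop)
    have o2 : IsOpen {q : ℝ × E | |q.1| * K < 1} := isOpen_lt (by fun_prop) (by fun_prop)
    have o3 : IsOpen {q : ℝ × E | dist q.2 p < δ} := isOpen_lt (by fun_prop) (by fun_prop)
    exact o1.inter (o2.inter (o3.inter (h.open_target.preimage hκ.continuous)))
  have hpO : ((0 : ℝ), p) ∈ O := by
    refine ⟨by simpa using hε, by simp, by simpa using hδ, ?_⟩
    have := h.map_source ha
    rw [hcoe] at this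
    convert this using 1
    simp only [κ, G, zero_smul, sub_zero]
    rfl
  have hsol : ∀ q ∈ O, α q.2 q.1 = (h.symm (κ q)).2 1 := by
    rintro ⟨s, x⟩ ⟨hs, hsK, hx, ht⟩
    simp only at hs hsK hx
    obtain ⟨hα0, hαd⟩ := hα x (le_of_lt hx)
    have hmem : ∀ t ∈ Icc (0 : ℝ) 1, s * t ∈ Ioo (0 - ε) (0 + ε) := by
      intro t ht
      have : |s * t| < ε := by
        rw [abs_mul, abs_of_nonneg ht.1]
        exact (mul_le_of_le_one_right (abs_nonneg _) ht.2).trans_lt hs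
      have := abs_lt.1 this
      constructor <;> linarith [this.1, this.2]
    have hcont : Continuous fun t : I => α x (s * t) := by
      rw [continuous_iff_continuousAt]
      intro t
      have h1 : ContinuousAt (α x) (s * t) := (hαd _ (hmem t t.2)).continuousAt
      exact ContinuousAt.comp (f := fun t : I => s * (t : ℝ)) h1 (by fun_prop)
    let u : C(I, E) := ⟨fun t => α x (s * t), hcont⟩
    have hGu : G (s, u) = κ (s, x) := by
      refine Prod.ext rfl ?_
      ext t
      change α x (s * t) - s • (stInt E (g.comp u)) t = x
      rw [stInt_apply, ← intervalIntegral.integral_smul]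
      have hcg : (∫ τ in (0:ℝ)..t, s • (g.comp u) (projIcc 0 1 zero_le_one τ)) =
          α x (s * t) - α x (s * 0) := by
        apply intervalIntegral.integral_eq_sub_of_hasDerivAt (f := fun τ => α x (s * τ))
        · intro τ hτ
          rw [uIcc_of_le t.2.1] at hτ
          have hτ' : τ ∈ Icc (0 : ℝ) 1 := ⟨hτ.1, hτ.2.trans t.2.2⟩
          have h1 := (hαd _ (hmem τ hτ')).scomp τ ((hasDerivAt_id τ).const_mul s)
          rw [projIcc_of_mem _ hτ']
          rw [mul_one] at h1
          exact h1
        · exact Continuous.intervalIntegrable (by fun_prop) _ _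
      rw [hcg, mul_zero, hα0]
      abel
    have hr' : G (h.symm (κ (s, x))) = κ (s, x) := by
      rw [← hcoe]; exact h.right_inv ht
    have hfst : (h.symm (κ (s, x))).1 = s := congrArg Prod.fst hr'
    have hu : u = (h.symm (κ (s, x))).2 := by
      apply hinj s _ _ hsK
      have h7 : h.symm (κ (s, x)) = (s, (h.symm (κ (s, x))).2) := Prod.ext hfst rfl
      rw [hGu, ← h7, hr']
    rw [← hu]
    simp [u]
  refine ⟨fun s x => α x s, O, hO.mem_nhds hpO, ?_⟩
  intro q hq
  obtain ⟨hα0, hαd⟩ := hα q.2 (le_of_lt hq.2.2.1)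
  refine ⟨hα0, hαd q.1 ?_, ?_⟩
  · have := abs_lt.1 hq.1
    constructor <;> linarith [this.1, this.2]
  · have h1 : ContDiffAt ℝ r (fun q => (h.symm (κ q)).2 1) q := by
      have h2 : ContDiffAt ℝ r (fun q => (h.symm (κ q)).2) q :=
        contDiffAt_snd.comp q ((hsymm _ hq.2.2.2).comp q hκ.contDiffAt)
      exact (ContinuousLinearMap.contDiff (E := C(I, E))
        (ContinuousMap.evalCLM ℝ (1 : I))).contDiffAt.comp q h2
    refine h1.congr_of_eventuallyEq ?_
    filter_upwards [hO.mem_nhds hq] with q' hq'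
    exact hsol q' hq'

/-- Theorem 4 (straightening with only `Cʳ` loss): a `Cʳ` vector field `ξ` (`r ≥ 1`)
nonvanishing at `p` can be straightened near `p` by a `Cʳ` coordinate transformation
`f`, i.e. `Σ_α ξ^α ∂f^h/∂x^α = δ^h₁`. -/
theorem straightening_theorem
    (n : ℕ) (hn : 1 ≤ n) (r : ℕ∞) (hr : 1 ≤ r)
    (W : Set (Fin n → ℝ)) (hW : IsOpen W) (p : Fin n → ℝ) (hp : p ∈ W)
    (ξ : (Fin n → ℝ) → (Fin n → ℝ)) (hξ : ContDiffOn ℝ r ξ W) (hξp : ξ p ≠ 0) :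
    ∃ (V : Set (Fin n → ℝ)) (f : (Fin n → ℝ) → (Fin n → ℝ)),
      IsOpen V ∧ p ∈ V ∧ V ⊆ W ∧
      ContDiffOn ℝ r f V ∧ Set.InjOn f V ∧
      (∀ x ∈ V, Function.Bijective (fderiv ℝ f x)) ∧
      IsOpen (f '' V) ∧
      (∀ x ∈ V, ∀ h : Fin n,
        ∑ α, ξ x α * pd α (fun y => f y h) x = if (h : ℕ) = 0 then 1 else 0) := by
  have hr1 : (1 : WithTop ℕ∞) ≤ r := by exact_mod_cast hr
  have hr0 : (r : WithTop ℕ∞) ≠ 0 := fun h => by rw [h] at hr1; simp at hr1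
  -- cut-off
  obtain ⟨d, hd, hdW⟩ := Metric.nhds_basis_closedBall.mem_iff.1 (hW.mem_nhds hp)
  let χ : ContDiffBump p := ⟨d / 2, d, by positivity, by linarith⟩
  have hgc : ContDiff ℝ r (fun x => χ x • ξ x) := by
    rw [contDiff_iff_contDiffAt]
    intro x
    by_cases hx : x ∈ tsupport χ
    · have hxW : x ∈ W := by
        rw [χ.tsupport_eq] at hx
        exact hdW hx
      exact χ.contDiff.contDiffAt.smul (hξ.contDiffAt (hW.mem_nhds hxW))
    · have h0 := notMem_tsupport_iff_eventuallyEq.1 hx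
      refine (contDiffAt_const (c := (0 : Fin n → ℝ))).congr_of_eventuallyEq ?_
      filter_upwards [h0] with y hy
      simp [hy]
  let g : C(Fin n → ℝ, Fin n → ℝ) := ⟨fun x => χ x • ξ x, hgc.continuous⟩
  have hgξ : ∀ x ∈ Metric.ball p (d / 2), g x = ξ x := by
    intro x hx
    have : χ x = 1 := χ.one_of_mem_closedBall (Metric.ball_subset_closedBall hx)
    simp [g, this]
  have hBW : Metric.ball p (d / 2) ⊆ W := fun x hx =>
    hdW (Metric.ball_subset_closedBall (Metric.ball_subset_ball (by linarith) hx))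
  have hpB : p ∈ Metric.ball p (d / 2) := Metric.mem_ball_self (by positivity)
  obtain ⟨K, hK⟩ := ContDiff.lipschitzWith_of_hasCompactSupport
    (χ.hasCompactSupport.smul_right (f' := ξ)) hgc hr0
  obtain ⟨Φ, N, hN, hΦ⟩ := st_flow (Fin n → ℝ) r hr g hgc K hK p
  -- linear change of coordinates
  let i0 : Fin n := ⟨0, hn⟩
  let e1 : Fin n → ℝ := Pi.single i0 1
  have he1 : e1 ≠ 0 := by
    intro h
    have := congrFun h i0
    simp [e1] at this
  have he1i : e1 i0 = 1 := by simp [e1]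
  obtain ⟨A, hA⟩ := SeparatingDual.exists_continuousLinearEquiv_apply_eq (R := ℝ) he1 hξp
  let π0 : (Fin n → ℝ) →L[ℝ] ℝ := ContinuousLinearMap.proj i0
  let B : (Fin n → ℝ) →L[ℝ] (Fin n → ℝ) :=
    (A : (Fin n → ℝ) →L[ℝ] (Fin n → ℝ)).comp
      (ContinuousLinearMap.id ℝ (Fin n → ℝ) - π0.smulRight e1)
  have hB : ∀ v, B v = A v - v i0 • ξ p := by
    intro v
    simp [B, π0, hA]
  have hBe : B e1 = 0 := by rw [hB, he1i, hA]; simp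
  let ρ : (Fin n → ℝ) → ℝ × (Fin n → ℝ) := fun y => (y i0, p + B y)
  have hρd : ∀ y, HasFDerivAt ρ (π0.prod B) y := by
    intro y
    exact π0.hasFDerivAt.prodMk (B.hasFDerivAt.const_add p)
  have hρc : ContDiff ℝ r ρ := π0.contDiff.prodMk (contDiff_const.add B.contDiff)
  have hρ0 : ρ 0 = (0, p) := by simp [ρ]
  let F : ℝ × (Fin n → ℝ) → (Fin n → ℝ) := fun q => Φ q.1 q.2
  let Ψ : (Fin n → ℝ) → (Fin n → ℝ) := fun y => F (ρ y)
  have hΨc : ∀ y, ρ y ∈ N → ContDiffAt ℝ r Ψ y := fun y hy =>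
    ContDiffAt.comp y (hΦ _ hy).2.2 hρc.contDiffAt
  have h0N : ρ 0 ∈ N := by rw [hρ0]; exact mem_of_mem_nhds hN
  have hΨ0 : Ψ 0 = p := by
    have := (hΦ _ (mem_of_mem_nhds hN)).1
    simpa [Ψ, F, hρ0] using this
  have hΨe : ∀ y, ρ y ∈ N → ∀ L : (Fin n → ℝ) →L[ℝ] (Fin n → ℝ),
      HasFDerivAt Ψ L y → L e1 = g (Ψ y) := by
    intro y hy L hL
    have h1 : HasDerivAt (fun t : ℝ => y + t • e1) e1 0 := by
      simpa using ((hasDerivAt_id (0 : ℝ)).smul_const e1).const_add y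
    have hL' : HasFDerivAt Ψ L (y + (0 : ℝ) • e1) := by simpa using hL
    have h2 : HasDerivAt (fun t : ℝ => Ψ (y + t • e1)) (L e1) 0 :=
      HasFDerivAt.comp_hasDerivAt (l := Ψ) (f := fun t : ℝ => y + t • e1) (0 : ℝ) hL' h1
    have h3 : HasDerivAt (fun t : ℝ => Φ (y i0 + t) (p + B y)) (g (Ψ y)) 0 := by
      have h4 := (hΦ _ hy).2.1
      have h5 : HasDerivAt (fun s => Φ s (p + B y)) (g (Ψ y)) (y i0 + 0) := by
        rw [add_zero]; exact h4
      exact HasDerivAt.comp_const_add (y i0) 0 h5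
    have h6 : (fun t : ℝ => Ψ (y + t • e1)) = fun t : ℝ => Φ (y i0 + t) (p + B y) := by
      funext t
      simp [Ψ, F, ρ, hBe, he1i]
    rw [h6] at h2
    exact h2.unique h3
  have hΨA : HasFDerivAt Ψ (A : (Fin n → ℝ) →L[ℝ] (Fin n → ℝ)) 0 := by
    have hFd : HasFDerivAt F (fderiv ℝ F (0, p)) (0, p) :=
      ((hΦ _ (mem_of_mem_nhds hN)).2.2.differentiableAt hr0).hasFDerivAt
    set L := fderiv ℝ F (0, p) with hL
    have hΨL : HasFDerivAt Ψ (L.comp (π0.prod B)) 0 := by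
      have hFd' : HasFDerivAt F L (ρ 0) := by rw [hρ0]; exact hFd
      exact hFd'.comp 0 (hρd 0)
    have hL1 : L (1, 0) = ξ p := by
      have := hΨe 0 h0N _ hΨL
      rw [hΨ0, hgξ p hpB] at this
      simpa [π0, he1i, hBe] using this
    have hL2 : ∀ v, L (0, v) = v := by
      have h1 : HasFDerivAt (fun x : Fin n → ℝ => F (0, x))
          (L.comp (ContinuousLinearMap.inr ℝ ℝ (Fin n → ℝ))) p :=
        HasFDerivAt.comp (f := fun x : Fin n → ℝ => ((0 : ℝ), x)) p hFd
          (hasFDerivAt_prodMk_right (0 : ℝ) p)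
      have h2 : HasFDerivAt (fun x : Fin n → ℝ => F (0, x))
          (ContinuousLinearMap.id ℝ (Fin n → ℝ)) p := by
        refine (hasFDerivAt_id p).congr_of_eventuallyEq ?_
        have hc : Continuous fun x : Fin n → ℝ => ((0 : ℝ), x) := by fun_prop
        filter_upwards [hc.continuousAt.preimage_mem_nhds hN] with x hx
        exact (hΦ _ hx).1
      intro v
      have := congrArg (fun T : (Fin n → ℝ) →L[ℝ] (Fin n → ℝ) => T v) (h1.unique h2)
      simpa using this
    refine hΨL.congr_fderiv ?_
    apply ContinuousLinearMap.ext
    intro v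
    have h3 : ((v i0, B v) : ℝ × (Fin n → ℝ)) = v i0 • (1, 0) + (0, B v) := by simp
    change L (v i0, B v) = A v
    rw [h3, map_add, map_smul, hL1, hL2, hB]
    abel
  have hU : {y | ρ y ∈ N ∧ Ψ y ∈ Metric.ball p (d / 2)} ∈ 𝓝 (0 : Fin n → ℝ) := by
    have n1 : ρ ⁻¹' N ∈ 𝓝 (0 : Fin n → ℝ) :=
      hρc.continuous.continuousAt.preimage_mem_nhds (by rw [hρ0]; exact hN)
    have n2 : Ψ ⁻¹' Metric.ball p (d / 2) ∈ 𝓝 (0 : Fin n → ℝ) :=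
      hΨA.continuousAt.preimage_mem_nhds (by rw [hΨ0]; exact Metric.isOpen_ball.mem_nhds hpB)
    filter_upwards [n1, n2] with y h1 h2
    exact ⟨h1, h2⟩
  obtain ⟨h, hcoe, h0, hsU, hder, hsymm⟩ :=
    st_local_diffeo r hr Ψ 0 _ hU (fun y hy => hΨc y hy.1) A hΨA
  have hmem : ∀ x ∈ h.target, Ψ (h.symm x) = x := by
    intro x hx
    rw [← hcoe]; exact h.right_inv hx
  have hinv : ∀ x ∈ h.target, ∃ e' : (Fin n → ℝ) ≃L[ℝ] (Fin n → ℝ), e' e1 = ξ x ∧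
      HasFDerivAt h.symm (e'.symm : (Fin n → ℝ) →L[ℝ] (Fin n → ℝ)) x := by
    intro x hx
    have hy := h.map_target hx
    obtain ⟨e', he'⟩ := hder _ hy
    refine ⟨e', ?_, ?_⟩
    · have h1 := hΨe _ (hsU hy).1 _ he'
      have h2 := (hsU hy).2
      rw [hmem x hx] at h1 h2
      rw [hgξ x h2] at h1
      exact h1
    · exact h.hasFDerivAt_symm hx (by rw [hcoe]; exact he')
  refine ⟨h.target, h.symm, h.open_target, ?_, ?_, ?_, h.symm.injOn, ?_, ?_, ?_⟩
  · have := h.map_source h0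
    rwa [hcoe, hΨ0] at this
  · intro x hx
    have h2 := (hsU (h.map_target hx)).2
    rw [hmem x hx] at h2
    exact hBW h2
  · exact fun x hx => (hsymm x hx).contDiffWithinAt
  · intro x hx
    obtain ⟨e', -, he'⟩ := hinv x hx
    rw [he'.fderiv]
    exact e'.symm.bijective
  · rw [h.symm_image_target_eq_source]
    exact h.open_source
  · intro x hx j
    obtain ⟨e', h1, he'⟩ := hinv x hx
    have hpd : ∀ a, pd a (fun y => h.symm y j) x = e'.symm (Pi.single a 1) j := by
      intro a
      have h2 : HasFDerivAt (fun y => h.symm y j) _ x := hasFDerivAt_pi'.1 he' j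
      rw [pd, h2.fderiv]
      rfl
    have h3 : e'.symm (ξ x) = e1 := by rw [← h1]; simp
    have h4 : ∑ a, ξ x a * e'.symm (Pi.single a 1) j = e'.symm (ξ x) j := by
      conv_rhs => rw [pi_eq_sum_univ' (ξ x)]
      simp only [map_sum, map_smul, Finset.sum_apply, Pi.smul_apply, smul_eq_mul]
    simp only [hpd]
    rw [h4, h3]
    simp [e1, i0, Pi.single_apply, Fin.ext_iff]
end
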